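/- Let R be a commutative noetherian ring, m a maximal ideal of R, and M an R-module. If Ext^n_R(k(m), M) = 0 for some integer n ≥ dim R_m, then Ext^i_R(k(m), M) = 0 for all i ≥ n, and sup{ i : Ext^i_R(k(m), M) ≠ 0 } = depth R_m − width_{R_m} M_m. -/

import Mathlib

open CategoryTheory Opposite

noncomputable section

/-- The `n`-th Ext group of `R`-modules `X` and `M`, i.e. `Ext^n_R(X, M)`. -/
def extModule (R : Type) [CommRing R] (n : ℕ) (X M : ModuleCat R) : ModuleCat R :=
  ((Ext R (ModuleCat R) n).obj (op X)).obj M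

/-- The `n`-th Tor group of `R`-modules `X` and `M`, i.e. `Tor_n^R(X, M)`. -/
def torModule (R : Type) [CommRing R] (n : ℕ) (X M : ModuleCat R) : ModuleCat R :=
  ((Tor (ModuleCat R) n).obj X).obj M

/-- The residue field `k(p) = R_p / p R_p` at a prime ideal `p`. -/
abbrev resField (R : Type) [CommRing R] (p : Ideal R) [p.IsPrime] : Type :=
  IsLocalRing.ResidueField (Localization.AtPrime p)

/-- `depth_R M := inf{ i : Ext^i_R(k, M) ≠ 0 }`, as an extended real (`⊤ = ∞` if all vanish). -/
noncomputable def edepth (R : Type) [CommRing R] (k M : ModuleCat R) : EReal :=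
  sInf {x : EReal | ∃ i : ℕ, x = (i : EReal) ∧ Nontrivial (extModule R i k M)}

/-- `width_R M := inf{ i : Tor_i^R(k, M) ≠ 0 }`, as an extended real (`⊤ = ∞` if all vanish). -/
noncomputable def ewidth (R : Type) [CommRing R] (k M : ModuleCat R) : EReal :=
  sInf {x : EReal | ∃ i : ℕ, x = (i : EReal) ∧ Nontrivial (torModule R i k M)}

/-- `sup{ i : Ext^i_R(k, M) ≠ 0 }`, as an extended real (`⊥ = -∞` if all vanish). -/
noncomputable def extSup (R : Type) [CommRing R] (k M : ModuleCat R) : EReal :=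
  sSup {x : EReal | ∃ i : ℕ, x = (i : EReal) ∧ Nontrivial (extModule R i k M)}

/-- `sup{ i : Tor_i^R(k, M) ≠ 0 }`, as an extended real (`⊥ = -∞` if all vanish). -/
noncomputable def torSup (R : Type) [CommRing R] (k M : ModuleCat R) : EReal :=
  sSup {x : EReal | ∃ i : ℕ, x = (i : EReal) ∧ Nontrivial (torModule R i k M)}

open Limits in
/-- Vanishing of `Ext` in terms of a projective resolution of the source. -/
lemma CategoryTheory.ProjectiveResolution.subsingleton_ext_iff {C : Type*} [Category* C]
    [Abelian C] [HasExt C] {X : C} (P : ProjectiveResolution X) (Y : C) (n : ℕ) :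
    Subsingleton (Abelian.Ext X Y n) ↔ ∀ f : P.complex.X n ⟶ Y, P.complex.d (n + 1) n ≫ f = 0 →
      ∃ g : P.complex.X ((ComplexShape.down ℕ).next n) ⟶ Y, P.complex.d n _ ≫ g = f := by
  cases n with
  | zero =>
    rw [Abelian.Ext.homEquiv₀.subsingleton_congr]
    have hd : P.complex.d 0 ((ComplexShape.down ℕ).next 0) = 0 :=
      P.complex.shape _ _ (by simp)
    simp only [hd, zero_comp]
    refine ⟨fun h f hf ↦ ?_, fun h ↦ ⟨fun a b ↦ ?_⟩⟩
    · obtain ⟨l, hl⟩ : ∃ l : X ⟶ Y, P.π.f 0 ≫ l = f := P.exact₀.desc' f (by simpa using hf)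
      exact ⟨0, by rw [← hl, Subsingleton.elim l 0]; exact comp_zero.symm⟩
    · rw [← sub_eq_zero]
      have hπ : P.complex.d 1 0 ≫ P.π.f 0 = 0 := P.complex_d_comp_π_f_zero
      let c : ((ChainComplex.single₀ C).obj X).X 0 ⟶ Y := a - b
      obtain ⟨g, hg⟩ := h (P.π.f 0 ≫ c) (by rw [← Category.assoc, hπ, zero_comp])
      exact (cancel_epi (P.π.f 0)).mp (hg.symm.trans comp_zero.symm)
  | succ n =>
    have hn : (ComplexShape.down ℕ).next (n + 1) = n := ComplexShape.next_eq' _ (by simp)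
    rw [hn]
    refine ⟨fun h f hf ↦ (P.extMk_eq_zero_iff f _ rfl hf n rfl).mp (Subsingleton.elim _ _),
      fun h ↦ subsingleton_of_forall_eq 0 fun α ↦ ?_⟩
    obtain ⟨f, hf, rfl⟩ := P.extMk_surjective α _ rfl
    exact (P.extMk_eq_zero_iff f _ rfl hf n rfl).mpr (h f hf)

lemma subsingleton_extModule_iff {R : Type} [CommRing R] (n : ℕ) (X M : ModuleCat.{0} R) :
    Subsingleton (extModule R n X M) ↔ Subsingleton (Abelian.Ext X M n) := by
  let P := projectiveResolution X
  have hprev : (ComplexShape.up ℕ).prev n = (ComplexShape.down ℕ).next n := rfl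
  rw [P.subsingleton_ext_iff, extModule, ← ModuleCat.isZero_iff_subsingleton,
    (P.isoExt n M).isZero_iff, ← HomologicalComplex.exactAt_iff_isZero_homology,
    HomologicalComplex.exactAt_iff' _ _ n (n + 1) hprev (by simp),
    ShortComplex.moduleCat_exact_iff]
  simp only [HomologicalComplex.shortComplexFunctor'_obj_f,
    HomologicalComplex.shortComplexFunctor'_obj_g, ChainComplex.linearYonedaObj_d]
  rfl

/-- Exactness over a field can be tested on dual spaces. -/
lemma LinearMap.exact_iff_forall_dual {K U V W : Type*} [Field K] [AddCommGroup U] [AddCommGroup V]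
    [AddCommGroup W] [Module K U] [Module K V] [Module K W] (u : U →ₗ[K] V) (v : V →ₗ[K] W)
    (huv : v ∘ₗ u = 0) :
    Function.Exact u v ↔ ∀ f : V →ₗ[K] K, f ∘ₗ u = 0 → ∃ g : W →ₗ[K] K, g ∘ₗ v = f := by
  refine ⟨fun h f hf ↦ ?_, fun h y ↦ ⟨fun hy ↦ ?_, ?_⟩⟩
  · have : f ∈ LinearMap.range v.dualMap := by
      rw [LinearMap.range_dualMap_eq_dualAnnihilator_ker, Submodule.mem_dualAnnihilator]
      intro w hw
      obtain ⟨x, rfl⟩ := (h w).mp hw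
      exact LinearMap.congr_fun hf x
    exact this
  · by_contra hy'
    obtain ⟨f, hf, hle⟩ := Submodule.exists_le_ker_of_notMem (p := LinearMap.range u) hy'
    obtain ⟨g, rfl⟩ := h f (LinearMap.range_le_ker_iff.mp hle)
    exact hf (by simp [hy])
  · rintro ⟨x, rfl⟩
    exact LinearMap.congr_fun huv x

lemma LinearMap.liftBaseChangeEquiv_comp_baseChange {A K X Y : Type*} [CommRing A] [Field K]
    [Algebra A K] [AddCommGroup X] [AddCommGroup Y] [Module A X] [Module A Y]
    (f : Y →ₗ[A] K) (w : X →ₗ[A] Y) :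
    LinearMap.liftBaseChangeEquiv K f ∘ₗ w.baseChange K =
      LinearMap.liftBaseChangeEquiv K (f ∘ₗ w) := by
  ext; simp

/-- Exactness of `K ⊗ U → K ⊗ V → K ⊗ W` can be tested on `K`-valued maps. -/
lemma LinearMap.exact_lTensor_iff_forall_dual {A K U V W : Type*} [CommRing A] [Field K]
    [Algebra A K] [AddCommGroup U] [AddCommGroup V]
    [AddCommGroup W] [Module A U] [Module A V] [Module A W] (u : U →ₗ[A] V) (v : V →ₗ[A] W)
    (huv : v ∘ₗ u = 0) :
    Function.Exact (u.lTensor K) (v.lTensor K) ↔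
      ∀ f : V →ₗ[A] K, f ∘ₗ u = 0 → ∃ g : W →ₗ[A] K, g ∘ₗ v = f := by
  have key := LinearMap.exact_iff_forall_dual (u.baseChange K) (v.baseChange K)
    (by rw [← LinearMap.baseChange_comp, huv, LinearMap.baseChange_zero])
  have hex : Function.Exact (u.lTensor K) (v.lTensor K) ↔
    Function.Exact (u.baseChange K) (v.baseChange K) := Iff.rfl
  rw [hex, key]
  constructor
  · intro h f hf
    obtain ⟨g, hg⟩ := h (LinearMap.liftBaseChangeEquiv K f)
      (by rw [LinearMap.liftBaseChangeEquiv_comp_baseChange, hf, map_zero])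
    refine ⟨(LinearMap.liftBaseChangeEquiv K).symm g,
      (LinearMap.liftBaseChangeEquiv K).injective ?_⟩
    rw [← LinearMap.liftBaseChangeEquiv_comp_baseChange, LinearEquiv.apply_symm_apply, hg]
  · intro h f hf
    obtain ⟨f, rfl⟩ := (LinearMap.liftBaseChangeEquiv K).surjective f
    rw [LinearMap.liftBaseChangeEquiv_comp_baseChange, LinearEquiv.map_eq_zero_iff] at hf
    obtain ⟨g, hg⟩ := h f hf
    exact ⟨LinearMap.liftBaseChangeEquiv K g, by
      rw [LinearMap.liftBaseChangeEquiv_comp_baseChange, hg]⟩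

lemma subsingleton_torModule_iff {A : Type} [CommRing A] (K : Type) [Field K] [Algebra A K]
    (n : ℕ) (N : ModuleCat.{0} A) :
    Subsingleton (torModule A n (ModuleCat.of A K) N) ↔
      Subsingleton (Abelian.Ext N (ModuleCat.of A K) n) := by
  let P := projectiveResolution N
  let F := (MonoidalCategory.tensoringLeft (ModuleCat.{0} A)).obj (ModuleCat.of A K)
  have hprev : (ComplexShape.down ℕ).prev n = n + 1 := by simp
  rw [P.subsingleton_ext_iff]
  have e : torModule A n (ModuleCat.of A K) N ≅ _ := P.isoLeftDerivedObj F n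
  rw [← ModuleCat.isZero_iff_subsingleton, e.isZero_iff]
  have hz : Limits.IsZero ((HomologicalComplex.homologyFunctor _ _ n).obj
      ((F.mapHomologicalComplex _).obj P.complex)) ↔
      ((F.mapHomologicalComplex _).obj P.complex).ExactAt n :=
    (HomologicalComplex.exactAt_iff_isZero_homology _ _).symm
  refine hz.trans ?_
  rw [HomologicalComplex.exactAt_iff' _ _ n ((ComplexShape.down ℕ).next n) hprev rfl,
    ShortComplex.ShortExact.moduleCat_exact_iff_function_exact]
  have h0 : (P.complex.d n ((ComplexShape.down ℕ).next n)).hom ∘ₗ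
      (P.complex.d (n + 1) n).hom = 0 := by
    rw [← ModuleCat.hom_comp, P.complex.d_comp_d, ModuleCat.hom_zero]
  refine (LinearMap.exact_lTensor_iff_forall_dual (K := K) _ _ h0).trans
    ⟨fun h f hf ↦ ?_, fun h f hf ↦ ?_⟩
  · obtain ⟨g, hg⟩ := h f.hom (by rw [← ModuleCat.hom_comp, hf, ModuleCat.hom_zero])
    exact ⟨ModuleCat.ofHom g, by ext : 1; simpa using hg⟩
  · obtain ⟨g, hg⟩ := h (ModuleCat.ofHom f) (by ext : 1; simpa using hf)
    exact ⟨g.hom, by rw [← ModuleCat.hom_comp, hg]; rfl⟩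

open Abelian in
lemma CategoryTheory.Abelian.Ext.subsingleton_of_iso {C : Type*} [Category* C] [Abelian C]
    [HasExt C] {X X' Y Y' : C} (e : X ≅ X') (e' : Y ≅ Y') (n : ℕ) [Subsingleton (Ext X Y n)] :
    Subsingleton (Ext X' Y' n) := by
  refine subsingleton_of_forall_eq 0 fun α ↦ ?_
  have h : (Ext.mk₀ e.hom).comp (α.comp (Ext.mk₀ e'.inv) (add_zero n)) (zero_add n) = 0 :=
    Subsingleton.elim _ _
  have h2 : (Ext.mk₀ e.inv).comp (((Ext.mk₀ e.hom).comp (α.comp (Ext.mk₀ e'.inv) (add_zero n))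
    (zero_add n)).comp (Ext.mk₀ e'.hom) (add_zero n)) (zero_add n) = α := by
    simp
  rw [← h2, h, Ext.zero_comp, Ext.comp_zero]

section

open Abelian Limits

variable {C D : Type*} [Category* C] [Abelian C] [Category* D] [Abelian D]
  (F : C ⥤ D) [F.Additive] [PreservesFiniteLimits F] [PreservesFiniteColimits F]

attribute [local simp] Ext.mapExactFunctor_comp Ext.mapExactFunctor_mk₀ Ext.mapExactFunctor_extClass
attribute [local instance] Ext.subsingleton_of_injective in
/-- An exact functor preserving injective objects induces bijections on `Ext` as soon as it does so
on morphisms. -/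
lemma CategoryTheory.Functor.mapExtAddHom_bijective [HasExt C] [HasExt D] [EnoughInjectives C]
    [F.PreservesInjectiveObjects] (X : C)
    (hX : ∀ Y : C, Function.Bijective (F.map : (X ⟶ Y) → (F.obj X ⟶ F.obj Y))) (Y : C) (n : ℕ) :
    Function.Bijective (F.mapExtAddHom X Y n) := by
  induction n generalizing Y with
  | zero => simpa [Ext.mapExactFunctor₀] using hX Y
  | succ n hn =>
    let I : InjectivePresentation Y := Classical.arbitrary _
    let S := ShortComplex.mk _ _ (cokernel.condition I.f)
    have : Injective (S.map F).X₂ := Functor.PreservesInjectiveObjects.injective_obj I.injective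
    have hS : S.ShortExact := { exact := ShortComplex.exact_cokernel I.f }
    exact AddMonoidHom.bijective_of_surjective_of_bijective_of_right_exact _ _ _ _
      (F.mapExtAddHom X S.X₂ n) (F.mapExtAddHom X S.X₃ n) (F.mapExtAddHom X S.X₁ (n + 1))
      (by cat_disch) (by cat_disch)
      ((ShortComplex.ab_exact_iff_function_exact _).mp
        (Ext.covariant_sequence_exact₃' X hS n (n + 1) rfl))
      ((ShortComplex.ab_exact_iff_function_exact _).mp
        (Ext.covariant_sequence_exact₃' (F.obj X) (hS.map F) n (n + 1) rfl))
      (hn _).surjective (hn _)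
      (fun x₁ ↦ Ext.covariant_sequence_exact₁ _ hS x₁ (by subsingleton) rfl)
      (fun y₁ ↦ Ext.covariant_sequence_exact₁ _ (hS.map F) y₁ (by subsingleton) rfl)

end

lemma IsLocalizedModule.bijective_of_isUnit {R M N : Type*} [CommRing R] [AddCommGroup M]
    [AddCommGroup N] [Module R M] [Module R N] (S : Submonoid R) (f : M →ₗ[R] N)
    [IsLocalizedModule S f] (h : ∀ s : S, IsUnit (algebraMap R (Module.End R M) s)) :
    Function.Bijective f := by
  have : IsLocalizedModule S (LinearMap.id : M →ₗ[R] M) :=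
    ⟨h, fun y ↦ ⟨⟨y, 1⟩, by simp⟩, by simpa using ⟨1, S.one_mem⟩⟩
  have h2 : (IsLocalizedModule.linearEquiv S (LinearMap.id : M →ₗ[R] M) f).toLinearMap = f := by
    ext x
    exact IsLocalizedModule.linearEquiv_apply S LinearMap.id f x
  rw [← h2]
  exact LinearEquiv.bijective _

lemma ModuleCat.subsingleton_ext_localizedModule_iff {R : Type} [CommRing R] [IsNoetherianRing R]
    (S : Submonoid R) (X M : ModuleCat.{0} R) [Module.Finite R X]
    (h : ∀ s : S, IsUnit (algebraMap R (Module.End R X) s)) (n : ℕ) :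
    Subsingleton (Abelian.Ext X M n) ↔
      Subsingleton (Abelian.Ext (X.localizedModule S) (M.localizedModule S) n) := by
  have : Module.FinitePresentation R X := Module.finitePresentation_of_finite R X
  refine (Equiv.ofBijective _ ((localizedModuleFunctor.{0} S).mapExtAddHom_bijective X
    (fun Y ↦ ?_) M n)).subsingleton_congr
  have hb : Function.Bijective (IsLocalizedModule.mapExtendScalars S
      (X.localizedModuleMkLinearMap S) (Y.localizedModuleMkLinearMap S) (Localization S)) := by
    apply IsLocalizedModule.bijective_of_isUnit S
    intro s
    have hs := (Module.End.isUnit_iff _).mp (h s)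
    let e := LinearEquiv.ofBijective _ hs
    rw [Module.End.isUnit_iff]
    constructor
    · intro f g hfg
      ext x
      obtain ⟨x, rfl⟩ := e.surjective x
      have := LinearMap.congr_fun hfg x
      simp only [Module.algebraMap_end_apply, LinearMap.smul_apply, ← map_smul] at this
      exact this
    · intro f
      refine ⟨f ∘ₗ e.symm.toLinearMap, ?_⟩
      ext x
      have h2 := e.symm_apply_apply x
      have h3 : e x = s • x := rfl
      simp only [Module.algebraMap_end_apply, LinearMap.smul_apply, LinearMap.comp_apply,
        LinearEquiv.coe_coe, ← map_smul]
      exact congrArg f h2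
  exact ((ModuleCat.homEquiv (M := X.localizedModule S)
    (N := Y.localizedModule S)).symm.bijective.comp hb).comp ModuleCat.homEquiv.bijective

lemma subsingleton_ext_residueField_iff {R : Type} [CommRing R] [IsNoetherianRing R] (m : Ideal R)
    [m.IsMaximal] (M : Type) [AddCommGroup M] [Module R M] (n : ℕ) :
    Subsingleton (Abelian.Ext (ModuleCat.of R (resField R m)) (ModuleCat.of R M) n) ↔
      Subsingleton (Abelian.Ext (ModuleCat.of (Localization.AtPrime m) (resField R m))
        (ModuleCat.of (Localization.AtPrime m) (LocalizedModule m.primeCompl M)) n) := by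
  let S := m.primeCompl
  let A := Localization.AtPrime m
  let k := ModuleCat.of R (resField R m)
  have hid : IsLocalizedModule S (LinearMap.id : k →ₗ[R] k) :=
    isLocalizedModule_id S (resField R m) A
  have hfin : Module.Finite R k := inferInstanceAs (Module.Finite R m.ResidueField)
  have hk := ModuleCat.localizedModule_isLocalizedModule k S
  rw [ModuleCat.subsingleton_ext_localizedModule_iff S k _
    (IsLocalizedModule.map_units (LinearMap.id : k →ₗ[R] k))]
  let e₁ : k.localizedModule S ≅ ModuleCat.of A (resField R m) :=
    (LinearEquiv.extendScalarsOfIsLocalization S A (IsLocalizedModule.linearEquiv S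
      (k.localizedModuleMkLinearMap S) (LinearMap.id : k →ₗ[R] k))).toModuleIso
  let e₂ : (ModuleCat.of R M).localizedModule S ≅ ModuleCat.of A (LocalizedModule S M) :=
    (Shrink.linearEquiv.{0} A (LocalizedModule S M)).toModuleIso
  exact ⟨fun _ ↦ Abelian.Ext.subsingleton_of_iso e₁ e₂ n,
    fun _ ↦ Abelian.Ext.subsingleton_of_iso e₁.symm e₂.symm n⟩

section

open Abelian

/-- `L` is a finite module killed by a power of `I`. -/
structure Module.IsFinitePowTorsion {A : Type*} [CommRing A] (I : Ideal A) (L : Type*)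
    [AddCommGroup L] [Module A L] : Prop where
  finite : Module.Finite A L
  exists_pow_le : ∃ N : ℕ, I ^ N ≤ Module.annihilator A L

namespace Module.IsFinitePowTorsion

variable {A L L' : Type*} [CommRing A] {I J : Ideal A} [AddCommGroup L] [Module A L]
  [AddCommGroup L'] [Module A L']

lemma of_surjective (h : IsFinitePowTorsion I L) (f : L →ₗ[A] L') (hf : Function.Surjective f) :
    IsFinitePowTorsion I L' := by
  obtain ⟨_, N, hN⟩ := h
  exact ⟨Module.Finite.of_surjective f hf, N, hN.trans (f.annihilator_le_of_surjective hf)⟩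

lemma of_injective [IsNoetherianRing A] (h : IsFinitePowTorsion I L') (f : L →ₗ[A] L')
    (hf : Function.Injective f) : IsFinitePowTorsion I L := by
  obtain ⟨_, N, hN⟩ := h
  exact ⟨Module.Finite.of_injective f hf, N, hN.trans (f.annihilator_le_of_injective hf)⟩

lemma mono (h : IsFinitePowTorsion I L) (hJ : J ≤ I) : IsFinitePowTorsion J L := by
  obtain ⟨_, N, hN⟩ := h
  exact ⟨inferInstance, N, (Ideal.pow_right_mono hJ N).trans hN⟩

lemma of_pow_le (h : IsFinitePowTorsion I L) {u : ℕ} (hJ : J ^ u ≤ I) :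
    IsFinitePowTorsion J L := by
  obtain ⟨_, N, hN⟩ := h
  exact ⟨inferInstance, u * N, by rw [pow_mul]; exact (Ideal.pow_right_mono hJ N).trans hN⟩

end Module.IsFinitePowTorsion

/-- Every class of degree greater than `c` in `Ext(L, M)` with `L` finite and killed by a power of
`I` is effaced by an epimorphism from a module of the same kind. -/
def Ideal.ExtEffaceable {A : Type} [CommRing A] (I : Ideal A) (M : ModuleCat.{0} A) (c : ℕ) :
    Prop :=
  ∀ (L : Type) [AddCommGroup L] [Module A L], Module.IsFinitePowTorsion I L → ∀ i, c < i →
    ∀ ξ : Ext (ModuleCat.of A L) M i, ∃ (L' : Type) (_ : AddCommGroup L') (_ : Module A L')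
      (π : L' →ₗ[A] L), Module.IsFinitePowTorsion I L' ∧ Function.Surjective π ∧
        (Ext.mk₀ (ModuleCat.ofHom π)).comp ξ (zero_add i) = 0

lemma Ideal.extEffaceable_bot {A : Type} [CommRing A] (M : ModuleCat.{0} A) :
    (⊥ : Ideal A).ExtEffaceable M 0 := by
  intro L _ _ hL i hi ξ
  have := hL.finite
  obtain ⟨r, π, hπ⟩ := Module.Finite.exists_fin' A L
  refine ⟨Fin r → A, inferInstance, inferInstance, π, ⟨inferInstance, 1, by simp⟩, hπ, ?_⟩
  obtain ⟨i, rfl⟩ := Nat.exists_eq_succ_of_ne_zero hi.ne'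
  have : Projective (ModuleCat.of A (Fin r → A)) := by
    rw [← IsProjective.iff_projective]; infer_instance
  exact Ext.eq_zero_of_projective _

lemma Submodule.smul_top_le_ker {A P X : Type*} [CommRing A] [AddCommGroup P] [Module A P]
    [AddCommGroup X] [Module A X] {J : Ideal A} (hJ : J ≤ Module.annihilator A X)
    (g : P →ₗ[A] X) : J • (⊤ : Submodule A P) ≤ LinearMap.ker g := by
  rw [Submodule.smul_le]
  intro a ha p _
  rw [LinearMap.mem_ker, map_smul, Module.mem_annihilator.mp (hJ ha)]

lemma Ideal.ExtEffaceable.sup_span_singleton {A : Type} [CommRing A] [IsNoetherianRing A]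
    {I : Ideal A} {M : ModuleCat.{0} A} {c : ℕ} (h : I.ExtEffaceable M c) (x : A) :
    (I ⊔ Ideal.span {x}).ExtEffaceable M (c + 1) := by
  intro L _ _ hL i hi ξ
  obtain ⟨i, rfl⟩ := Nat.exists_eq_succ_of_ne_zero (Nat.ne_zero_of_lt hi)
  obtain ⟨L', _, _, π₀, hL', hπ₀, hξ⟩ := h L (hL.mono le_sup_left) (i + 1) (by lia) ξ
  obtain ⟨_, t, ht⟩ := hL.mono (le_sup_right : Ideal.span {x} ≤ _)
  rw [Ideal.span_singleton_pow, Ideal.span_singleton_le_iff_mem, Module.mem_annihilator] at ht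
  have hS₀ := LinearMap.shortExact_shortComplexKer hπ₀
  obtain ⟨η, hη⟩ := Ext.contravariant_sequence_exact₃ hS₀ M ξ hξ (add_comm 1 i)
  let μ : L' →ₗ[A] L' := LinearMap.lsmul A L' (x ^ t)
  let j : LinearMap.range μ →ₗ[A] LinearMap.ker π₀ := Submodule.inclusion <| by
    rintro _ ⟨y, rfl⟩
    simp [μ, ht]
  obtain ⟨H', _, _, p, hH', hp, hη'⟩ := h (LinearMap.range μ)
    (hL'.of_injective (Submodule.subtype _) (Submodule.injective_subtype _)) i (by lia)
    ((Ext.mk₀ (ModuleCat.ofHom j)).comp η (zero_add i))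
  obtain ⟨_, N₁, hN₁⟩ := hL'
  obtain ⟨_, N₂, hN₂⟩ := hH'
  let J : Ideal A := I ^ (max N₁ N₂)
  have hJ₁ : J ≤ Module.annihilator A L' := (Ideal.pow_le_pow_right (le_max_left _ _)).trans hN₁
  have hJ₂ : J ≤ Module.annihilator A H' := (Ideal.pow_le_pow_right (le_max_right _ _)).trans hN₂
  obtain ⟨r, q₀, hq₀⟩ := Module.Finite.exists_fin' A L'
  let F := (Fin r → A) ⧸ (J • (⊤ : Submodule A (Fin r → A)))
  let q : F →ₗ[A] L' := Submodule.liftQ _ q₀ (Submodule.smul_top_le_ker hJ₁ q₀)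
  have hq : Function.Surjective q := fun y ↦ by
    obtain ⟨z, rfl⟩ := hq₀ y
    exact ⟨Submodule.Quotient.mk z, rfl⟩
  obtain ⟨φ₀, hφ₀⟩ := Module.projective_lifting_property p (μ.rangeRestrict ∘ₗ q₀) hp
  let φ : F →ₗ[A] H' := Submodule.liftQ _ φ₀ (Submodule.smul_top_le_ker hJ₂ φ₀)
  have hφ (y : F) : (p (φ y) : L') = x ^ t • q y := by
    obtain ⟨z, rfl⟩ := Submodule.Quotient.mk_surjective _ y
    exact congrArg Subtype.val (LinearMap.congr_fun hφ₀ z)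
  let f : F →ₗ[A] F := LinearMap.lsmul A F x
  have hf (n : ℕ) (y : F) : (f ^ n) y = x ^ n • y := by
    induction n with
    | zero => simp
    | succ n ih => rw [pow_succ', Module.End.mul_apply, ih, pow_succ', mul_smul]; rfl
  obtain ⟨s, hs⟩ := Filter.eventually_atTop.mp
    (Module.End.eventually_disjoint_ker_pow_range_pow f)
  let s' := max s t
  let D := LinearMap.range (f ^ (s' + t))
  let κ : D →ₗ[A] LinearMap.ker π₀ := (q ∘ₗ D.subtype).codRestrict _ <| by
    rintro ⟨_, y, rfl⟩
    simp [hf, pow_add, ht, smul_comm (x ^ s')]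
  let e₀ : LinearMap.range (f ^ s') →ₗ[A] D :=
    ((f ^ t) ∘ₗ Submodule.subtype _).codRestrict _ <| by
      rintro ⟨_, y, rfl⟩
      exact ⟨y, by rw [add_comm s' t, pow_add]; rfl⟩
  have he₀ : Function.Bijective e₀ := by
    constructor
    · rw [← LinearMap.ker_eq_bot, LinearMap.ker_eq_bot']
      rintro ⟨y, hy⟩ hy0
      have h1 : (f ^ t) y = 0 := congrArg Subtype.val hy0
      have h2 : (f ^ s') y = 0 := by
        rw [← Nat.sub_add_cancel (show t ≤ s' from le_max_right s t), pow_add,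
          Module.End.mul_apply, h1,
          map_zero]
      ext
      exact Submodule.disjoint_def.mp (hs s' (le_max_left _ _)) y h2 hy
    · rintro ⟨_, y, rfl⟩
      refine ⟨⟨(f ^ s') y, y, rfl⟩, ?_⟩
      ext
      change (f ^ t) ((f ^ s') y) = (f ^ (s' + t)) y
      rw [add_comm s' t, pow_add]; rfl
  let e := LinearEquiv.ofBijective e₀ he₀
  have hκ : κ = j ∘ₗ p ∘ₗ φ ∘ₗ Submodule.subtype _ ∘ₗ e.symm.toLinearMap := by
    rw [← LinearMap.comp_assoc, ← LinearMap.comp_assoc, ← LinearMap.comp_assoc,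
      LinearEquiv.eq_comp_toLinearMap_symm]
    ext y
    change q ((f ^ t) (y : F)) = (p (φ (y : F)) : L')
    rw [hφ, hf, map_smul]
  have hκη : (Ext.mk₀ (ModuleCat.ofHom κ)).comp η (zero_add i) = 0 := by
    have : ModuleCat.ofHom κ = ModuleCat.ofHom (φ ∘ₗ Submodule.subtype _ ∘ₗ e.symm.toLinearMap) ≫
        ModuleCat.ofHom p ≫ ModuleCat.ofHom j := by
      rw [hκ]; rfl
    rw [this, ← Ext.mk₀_comp_mk₀, ← Ext.mk₀_comp_mk₀, Ext.comp_assoc_of_second_deg_zero,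
      Ext.comp_assoc_of_second_deg_zero, hη', Ext.comp_zero]
  have hDπ : D ≤ LinearMap.ker (π₀ ∘ₗ q) := by
    rintro y hy
    exact (κ ⟨y, hy⟩).2
  let τ : F ⧸ D →ₗ[A] L := D.liftQ (π₀ ∘ₗ q) hDπ
  let S : ShortComplex (ModuleCat.{0} A) :=
    .mk (ModuleCat.ofHom D.subtype) (ModuleCat.ofHom D.mkQ) (by ext; simp)
  have hS : S.ShortExact := ModuleCat.shortComplex_shortExact S
    (LinearMap.exact_subtype_mkQ D) D.injective_subtype D.mkQ_surjective
  let Φ : S ⟶ π₀.shortComplexKer :=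
    { τ₁ := ModuleCat.ofHom κ
      τ₂ := ModuleCat.ofHom q
      τ₃ := ModuleCat.ofHom τ
      comm₁₂ := rfl
      comm₂₃ := rfl }
  refine ⟨F ⧸ D, inferInstance, inferInstance, τ, ⟨inferInstance, max N₁ N₂ + (s' + t), ?_⟩, ?_, ?_⟩
  · refine (Ideal.sup_pow_add_le_pow_sup_pow).trans (sup_le ?_ ?_)
    · intro a ha
      rw [Module.mem_annihilator]
      intro y
      obtain ⟨y, rfl⟩ := D.mkQ_surjective y
      obtain ⟨y, rfl⟩ := Submodule.Quotient.mk_surjective _ y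
      have : a • y ∈ J • (⊤ : Submodule A (Fin r → A)) := Submodule.smul_mem_smul ha trivial
      rw [← map_smul, ← Submodule.Quotient.mk_smul, (Submodule.Quotient.mk_eq_zero _).mpr this,
        map_zero]
    · rw [Ideal.span_singleton_pow, Ideal.span_singleton_le_iff_mem, Module.mem_annihilator]
      intro y
      obtain ⟨y, rfl⟩ := D.mkQ_surjective y
      rw [← map_smul, ← hf]
      exact (Submodule.Quotient.mk_eq_zero _).mpr ⟨y, rfl⟩
  · intro y
    obtain ⟨z, rfl⟩ := (hπ₀.comp hq) y
    exact ⟨D.mkQ z, rfl⟩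
  · have := ShortComplex.ShortExact.extClass_naturality hS hS₀ Φ
    rw [← hη, ← Ext.comp_assoc (a₁₂ := 1) _ _ _ (by lia) (by lia) (by lia)]
    refine (congrArg (fun z ↦ Ext.comp z η (add_comm 1 i)) this.symm).trans ?_
    rw [Ext.comp_assoc_of_second_deg_zero]
    refine (congrArg (fun z ↦ Ext.comp hS.extClass z (add_comm 1 i)) hκη).trans
      (Ext.comp_zero _ _ _ _ _)

end

section

open Abelian

lemma Ideal.extEffaceable_ofList {A : Type} [CommRing A] [IsNoetherianRing A] (M : ModuleCat.{0} A)
    (l : List A) : (Ideal.ofList l).ExtEffaceable M l.length := by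
  induction l with
  | nil => simpa using Ideal.extEffaceable_bot M
  | cons x l ih =>
    rw [Ideal.ofList_cons, sup_comm, List.length_cons]
    exact ih.sup_span_singleton x

namespace IsLocalRing

variable {A : Type} [CommRing A] [IsNoetherianRing A] [IsLocalRing A]

/-- The residue field of `A`, as an object of the category of `A`-modules. -/
abbrev residueModule (A : Type) [CommRing A] [IsLocalRing A] : ModuleCat.{0} A :=
  ModuleCat.of A (ResidueField A)

/-- Dévissage: a property of modules stable under extensions which holds for the residue field
holds for all finite modules killed by a power of the maximal ideal. -/
lemma devissage {P : ModuleCat.{0} A → Prop} (hzero : ∀ X, Limits.IsZero X → P X)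
    (hk : ∀ X, Nonempty (X ≅ residueModule A) → P X)
    (hext : ∀ S : ShortComplex (ModuleCat.{0} A), S.ShortExact → P S.X₁ → P S.X₃ → P S.X₂)
    (L : Type) [AddCommGroup L] [Module A L]
    (hL : Module.IsFinitePowTorsion (maximalIdeal A) L) : P (ModuleCat.of A L) := by
  obtain ⟨hfin, hL⟩ := hL
  revert hL
  refine IsNoetherianRing.induction_on_isQuotientEquivQuotientPrime A hfin
    (motive := fun N _ _ _ ↦ (∃ n : ℕ, maximalIdeal A ^ n ≤ Module.annihilator A N) →
      P (ModuleCat.of A N)) ?_ ?_ ?_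
  · intro N _ _ _ _ _
    exact hzero _ (ModuleCat.isZero_of_subsingleton _)
  · rintro N _ _ _ p e ⟨n, hn⟩
    rw [e.annihilator_eq, Ideal.annihilator_quotient] at hn
    have : p.1 = maximalIdeal A :=
      (((maximalIdeal.isMaximal A).eq_of_le p.2.ne_top (p.2.le_of_pow_le hn))).symm
    exact hk _ ⟨(e.trans (Submodule.quotEquivOfEq _ _ this)).toModuleIso⟩
  · intro N₁ _ _ _ N₂ _ _ _ N₃ _ _ _ f g hf hg hfg h₁ h₃ ⟨n, hn⟩
    refine hext (.mk (ModuleCat.ofHom f) (ModuleCat.ofHom g)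
      (by ext x; exact hfg.apply_apply_eq_zero x))
      (ModuleCat.shortComplex_shortExact _ hfg hf hg)
      (h₁ ⟨n, hn.trans (f.annihilator_le_of_injective hf)⟩)
      (h₃ ⟨n, hn.trans (g.annihilator_le_of_surjective hg)⟩)

lemma isFinitePowTorsion_residueField {A : Type*} [CommRing A] [IsLocalRing A] :
    Module.IsFinitePowTorsion (maximalIdeal A) (ResidueField A) :=
  ⟨inferInstance, 1, by
    rw [pow_one]; exact (Ideal.annihilator_quotient (I := maximalIdeal A)).ge⟩

lemma exists_list_pow_le :
    ∃ l : List A, (l.length : WithBot ℕ∞) = ringKrullDim A ∧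
      Ideal.ofList l ≤ maximalIdeal A ∧ ∃ u : ℕ, maximalIdeal A ^ u ≤ Ideal.ofList l := by
  obtain ⟨s, hs, hcard⟩ :=
    (maximalIdeal A).exists_finset_card_eq_height_of_isNoetherianRing
  have hspan : Ideal.ofList s.toList = Ideal.span (s : Set A) := by
    simp [Ideal.ofList]
  refine ⟨s.toList, ?_, hspan ▸ hs.1.2, ?_⟩
  · rw [← maximalIdeal_height_eq_ringKrullDim, ← hcard, Finset.length_toList]
    rfl
  · rw [hspan]
    refine Ideal.exists_pow_le_of_le_radical_of_fg ?_ (IsNoetherian.noetherian _)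
    rw [Ideal.radical_eq_sInf]
    refine le_sInf fun q ⟨hq, hq'⟩ ↦ hs.2 ⟨hq', hq⟩ (le_maximalIdeal hq'.ne_top)

lemma subsingleton_ext_succ (N : ModuleCat.{0} A) (n : ℕ) (hn : ringKrullDim A ≤ n)
    (h : Subsingleton (Ext (residueModule A) N n)) :
    Subsingleton (Ext (residueModule A) N (n + 1)) := by
  obtain ⟨l, hl, hlm, u, hu⟩ := exists_list_pow_le (A := A)
  rw [← hl] at hn
  have hln : l.length ≤ n := by exact_mod_cast hn
  refine subsingleton_of_forall_eq 0 fun ξ ↦ ?_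
  obtain ⟨L, _, _, π, hL, hπ, hξ⟩ := Ideal.extEffaceable_ofList N l (ResidueField A)
    (isFinitePowTorsion_residueField.mono hlm) (n + 1) (by lia) ξ
  have hS := LinearMap.shortExact_shortComplexKer hπ
  obtain ⟨η, rfl⟩ := Ext.contravariant_sequence_exact₃ hS N ξ hξ (add_comm 1 n)
  have hker : Subsingleton (Ext (ModuleCat.of A (LinearMap.ker π)) N n) := by
    refine devissage (P := fun X ↦ Subsingleton (Ext X N n)) ?_ ?_ ?_ _
      ((hL.of_injective _ (Submodule.injective_subtype _)).of_pow_le hu)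
    · refine fun X hX ↦ subsingleton_of_forall_eq 0 fun α ↦ ?_
      rw [← Ext.mk₀_id_comp α, hX.eq_of_src (𝟙 X) 0, Ext.mk₀_zero, Ext.zero_comp]
    · rintro X ⟨e⟩
      exact Ext.subsingleton_of_iso e.symm (Iso.refl N) n
    · intro S hS h₁ h₃
      refine subsingleton_of_forall_eq 0 fun α ↦ ?_
      obtain ⟨β, rfl⟩ := Ext.contravariant_sequence_exact₂ hS N α (Subsingleton.elim _ _)
      rw [Subsingleton.elim β 0, Ext.comp_zero]
  exact (congrArg (fun z ↦ Ext.comp hS.extClass z (add_comm 1 n))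
    (Subsingleton.elim (α := Ext (ModuleCat.of A (LinearMap.ker π)) N n) η 0)).trans
      (Ext.comp_zero _ _ _ _ _)

end IsLocalRing

end

lemma LinearEquiv.smul_surjective_iff {R M N : Type*} [CommRing R] [AddCommGroup M] [AddCommGroup N]
    [Module R M] [Module R N] (e : M ≃ₗ[R] N) (x : R) :
    Function.Surjective (fun m : M ↦ x • m) ↔ Function.Surjective (fun n : N ↦ x • n) := by
  rw [← e.surjective.of_comp_iff, ← e.comp_surjective]
  congr! 1
  ext
  simp

lemma LinearEquiv.smul_injective_iff {R M N : Type*} [CommRing R] [AddCommGroup M] [AddCommGroup N]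
    [Module R M] [Module R N] (e : M ≃ₗ[R] N) (x : R) :
    Function.Injective (fun m : M ↦ x • m) ↔ Function.Injective (fun n : N ↦ x • n) := by
  rw [← e.injective.of_comp_iff, ← e.injective_comp]
  congr! 1
  ext
  simp

namespace CategoryTheory.Pretriangulated

open Limits

section Shift

variable (R : Type*) [CommRing R] {C : Type*} [Category C] [Preadditive C] [HasShift C ℤ]
  [Linear R C]
  [∀ n : ℤ, (shiftFunctor C n).Additive] [∀ n : ℤ, (shiftFunctor C n).Linear R]

/-- Shifting is an `R`-linear equivalence on spaces of morphisms. -/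
def shiftHomLinearEquiv (U V : C) (a : ℤ) : (U ⟶ V) ≃ₗ[R] (U⟦a⟧ ⟶ V⟦a⟧) :=
  LinearEquiv.ofBijective ((shiftFunctor C a).mapLinearMap R)
    ⟨(shiftFunctor C a).map_injective, (shiftFunctor C a).map_surjective⟩

/-- Morphisms between shifts depend only on the difference of the shifts. -/
def shiftShiftHomLinearEquiv (U V : C) (a b i : ℤ) (h : i + a = b) :
    (U⟦a⟧ ⟶ V⟦b⟧) ≃ₗ[R] (U ⟶ V⟦i⟧) :=
  (Linear.homCongr R (Iso.refl _) ((shiftFunctorAdd' C i a b h).app V)).trans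
    (shiftHomLinearEquiv R U (V⟦i⟧) a).symm

/-- Moving a shift from the source to the target. -/
def shiftSourceHomLinearEquiv (U V : C) (a i : ℤ) (h : i + a = 0) :
    (U⟦a⟧ ⟶ V) ≃ₗ[R] (U ⟶ V⟦i⟧) :=
  (Linear.homCongr R (Iso.refl _) ((shiftFunctorZero C ℤ).symm.app V)).trans
    (shiftShiftHomLinearEquiv R U V a 0 i h)

end Shift

section Vanishing

variable {C : Type*} [Category C] [HasShift C ℤ]

/-- There is no nonzero morphism of degree `i` from `U` to `V`. -/
def HomVanishes (U V : C) (i : ℤ) : Prop := Subsingleton (U ⟶ V⟦i⟧)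

variable {U V : C}

lemma HomVanishes.of_iso {U' V' : C} {i : ℤ} (e : U ≅ U') (e' : V ≅ V')
    (h : HomVanishes U V i) : HomVanishes U' V' i := by
  have : Subsingleton (U ⟶ V⟦i⟧) := h
  exact (Iso.homCongr e ((shiftFunctor C i).mapIso e')).symm.subsingleton

lemma homVanishes_iff_of_iso {U' V' : C} {i : ℤ} (e : U ≅ U') (e' : V ≅ V') :
    HomVanishes U V i ↔ HomVanishes U' V' i :=
  ⟨.of_iso e e', .of_iso e.symm e'.symm⟩

lemma homVanishes_shift_target {a i j : ℤ} (h : a + i = j) :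
    HomVanishes U (V⟦a⟧) i ↔ HomVanishes U V j :=
  (Iso.homCongr (Iso.refl U) ((shiftFunctorAdd' C a i j h).symm.app V)).subsingleton_congr

lemma homVanishes_zero : HomVanishes U V 0 ↔ Subsingleton (U ⟶ V) :=
  (Iso.homCongr (Iso.refl U) ((shiftFunctorZero C ℤ).app V)).subsingleton_congr

variable [Preadditive C]

lemma HomVanishes.eq_zero {i : ℤ} (h : HomVanishes U V i) (f : U ⟶ V⟦i⟧) : f = 0 :=
  h.elim _ _

lemma homVanishes_of_forall {i : ℤ} (h : ∀ f : U ⟶ V⟦i⟧, f = 0) : HomVanishes U V i :=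
  ⟨fun f g ↦ (h f).trans (h g).symm⟩

variable [∀ n : ℤ, (shiftFunctor C n).Additive]

lemma homVanishes_shift_source {a i j : ℤ} (h : j + a = i) :
    HomVanishes (U⟦a⟧) V i ↔ HomVanishes U V j :=
  have (n : ℤ) : (shiftFunctor C n).Linear ℤ := inferInstance
  (shiftShiftHomLinearEquiv ℤ U V a i j h).toEquiv.subsingleton_congr

lemma subsingleton_shift_source {a i : ℤ} (h : i + a = 0) :
    Subsingleton (U⟦a⟧ ⟶ V) ↔ HomVanishes U V i :=
  have (n : ℤ) : (shiftFunctor C n).Linear ℤ := inferInstance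
  (shiftSourceHomLinearEquiv ℤ U V a i h).toEquiv.subsingleton_congr

variable [HasZeroObject C] [Pretriangulated C]

lemma HomVanishes.obj₂_target {T : Triangle C} (hT : T ∈ distTriang C) {i : ℤ}
    (h₁ : HomVanishes U T.obj₁ i) (h₃ : HomVanishes U T.obj₃ i) : HomVanishes U T.obj₂ i := by
  rw [← subsingleton_shift_source (add_neg_cancel i)] at h₁ h₃ ⊢
  refine ⟨fun f g ↦ ?_⟩
  obtain ⟨u, hu⟩ := T.coyoneda_exact₂ hT (f - g) (h₃.elim _ _)
  rw [h₁.elim u 0, zero_comp] at hu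
  exact sub_eq_zero.1 hu

lemma HomVanishes.obj₂_source {T : Triangle C} (hT : T ∈ distTriang C) {i : ℤ}
    (h₁ : HomVanishes T.obj₁ V i) (h₃ : HomVanishes T.obj₃ V i) : HomVanishes T.obj₂ V i := by
  refine homVanishes_of_forall fun f ↦ ?_
  obtain ⟨u, rfl⟩ := T.yoneda_exact₂ hT f (h₁.eq_zero _)
  rw [h₃.eq_zero u, comp_zero]

/-- If `T.obj₃` has no morphisms of degree `i + 1` to `V`, then morphisms of degree `i` extend
along `T.mor₁`. -/
lemma HomVanishes.obj₁_source_of_obj₂ {T : Triangle C} (hT : T ∈ distTriang C) {i j : ℤ}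
    (hij : i + 1 = j) (h₂ : HomVanishes T.obj₂ V i) (h₃ : HomVanishes T.obj₃ V j) :
    HomVanishes T.obj₁ V i := by
  refine HomVanishes.obj₂_source (inv_rot_of_distTriang _ hT) (V := V) (i := i) ?_ h₂
  exact (homVanishes_shift_source (by lia)).2 h₃

lemma HomVanishes.obj₃_source {T : Triangle C} (hT : T ∈ distTriang C) {i j : ℤ}
    (hij : j + 1 = i) (h₂ : HomVanishes T.obj₂ V i) (h₁ : HomVanishes T.obj₁ V j) :
    HomVanishes T.obj₃ V i :=
  HomVanishes.obj₂_source (rot_of_distTriang _ hT) (V := V) (i := i) h₂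
    ((homVanishes_shift_source (by lia)).2 h₁)

lemma HomVanishes.obj₁_target_of_obj₂ {T : Triangle C} (hT : T ∈ distTriang C) {i j : ℤ}
    (hij : j + 1 = i) (h₂ : HomVanishes U T.obj₂ i) (h₃ : HomVanishes U T.obj₃ j) :
    HomVanishes U T.obj₁ i :=
  HomVanishes.obj₂_target (inv_rot_of_distTriang _ hT) (U := U) (i := i)
    ((homVanishes_shift_target (by lia)).2 h₃) h₂

lemma HomVanishes.obj₃_target {T : Triangle C} (hT : T ∈ distTriang C) {i j : ℤ}
    (hij : i + 1 = j) (h₂ : HomVanishes U T.obj₂ i) (h₁ : HomVanishes U T.obj₁ j) :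
    HomVanishes U T.obj₃ i :=
  HomVanishes.obj₂_target (rot_of_distTriang _ hT) (U := U) (i := i) h₂
    ((homVanishes_shift_target (by lia)).2 h₁)

end Vanishing

section Koszul

variable {R : Type*} [CommRing R] {C : Type*} [Category C] [Preadditive C] [HasShift C ℤ]
  [Linear R C]
  {U V : C}

lemma homVanishes_iff_surjective_of_smul {i : ℤ} (x : R) (hx : ∀ f : U ⟶ V⟦i⟧, x • f = 0) :
    HomVanishes U V i ↔ Function.Surjective (fun f : U ⟶ V⟦i⟧ ↦ x • f) := by
  refine ⟨fun h f ↦ ⟨0, h.elim _ _⟩, fun h ↦ homVanishes_of_forall fun f ↦ ?_⟩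
  obtain ⟨g, rfl⟩ := h f
  exact hx g

lemma homVanishes_iff_injective_of_smul {i : ℤ} (x : R) (hx : ∀ f : U ⟶ V⟦i⟧, x • f = 0) :
    HomVanishes U V i ↔ Function.Injective (fun f : U ⟶ V⟦i⟧ ↦ x • f) :=
  ⟨fun h _ _ _ ↦ h.elim _ _, fun h ↦ homVanishes_of_forall fun f ↦ h (by simp [hx])⟩

variable [∀ n : ℤ, (shiftFunctor C n).Additive] [HasZeroObject C] [Pretriangulated C]

/-- The cone of multiplication by `x` on `U`. -/
def smulCone (x : R) (U : C) : C := (distinguished_cocone_triangle (x • 𝟙 U)).choose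

lemma exists_smulCone_distinguished (x : R) (U : C) :
    ∃ (g : U ⟶ smulCone x U) (h : smulCone x U ⟶ U⟦(1 : ℤ)⟧),
      Triangle.mk (x • 𝟙 U) g h ∈ distTriang C :=
  (distinguished_cocone_triangle (x • 𝟙 U)).choose_spec

/-- The iterated cone of multiplications by the elements of `l`. -/
def koszul (l : List R) (U : C) : C := l.foldr smulCone U

lemma koszul_cons (x : R) (l : List R) (U : C) : koszul (x :: l) U = smulCone x (koszul l U) := rfl

lemma koszul_concat (x : R) (l : List R) (U : C) :
    koszul (l ++ [x]) U = koszul l (smulCone x U) := by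
  simp [koszul]

lemma sq_smul_id_eq_zero {T : Triangle C} (hT : T ∈ distTriang C) (r : R)
    (h₂ : r • T.mor₂ = 0) (h₃ : r • T.mor₃ = 0) : r ^ 2 • 𝟙 T.obj₃ = 0 := by
  obtain ⟨g, hg⟩ := T.coyoneda_exact₃ hT (r • 𝟙 T.obj₃) (by simpa using h₃)
  rw [pow_two, mul_smul, hg, ← Linear.comp_smul, h₂, comp_zero]

variable [∀ n : ℤ, (shiftFunctor C n).Linear R]

lemma exists_smulCone_distinguished_smul_eq_zero (x : R) (U : C) :
    ∃ (g : U ⟶ smulCone x U) (h : smulCone x U ⟶ U⟦(1 : ℤ)⟧),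
      Triangle.mk (x • 𝟙 U) g h ∈ distTriang C ∧ x • g = 0 ∧ x • h = 0 := by
  obtain ⟨g, h, hT⟩ := exists_smulCone_distinguished x U
  refine ⟨g, h, hT, ?_, ?_⟩
  · have : (x • 𝟙 U) ≫ g = 0 := comp_distTriang_mor_zero₁₂ _ hT
    rwa [Linear.smul_comp, Category.id_comp] at this
  · have : h ≫ (shiftFunctor C (1 : ℤ)).map (x • 𝟙 U) = 0 := comp_distTriang_mor_zero₃₁ _ hT
    rwa [Functor.map_smul, Functor.map_id, Linear.comp_smul, Category.comp_id] at this

lemma sq_smul_id_smulCone (x : R) (U : C) : x ^ 2 • 𝟙 (smulCone x U) = 0 := by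
  obtain ⟨g, h, hT, hg, hh⟩ := exists_smulCone_distinguished_smul_eq_zero x U
  exact sq_smul_id_eq_zero hT x hg hh

lemma sq_smul_id_smulCone_of_smul_id (r x : R) (U : C) (hr : r • 𝟙 U = 0) :
    r ^ 2 • 𝟙 (smulCone x U) = 0 := by
  obtain ⟨g, h, hT⟩ := exists_smulCone_distinguished x U
  refine sq_smul_id_eq_zero hT r ?_ ?_
  · change r • g = 0
    rw [← Category.id_comp g, ← Linear.smul_comp, hr, zero_comp]
  · change r • h = 0
    rw [← Category.comp_id h, ← Linear.comp_smul, ← (shiftFunctor C (1 : ℤ)).map_id,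
      ← Functor.map_smul, hr, Functor.map_zero, comp_zero]

lemma exists_pow_smul_id_koszul (l : List R) (U : C)
    (x : R) (hx : x ∈ l) : ∃ n : ℕ, x ^ n • 𝟙 (koszul l U) = 0 := by
  induction l with
  | nil => simp at hx
  | cons y l ih =>
    rcases List.mem_cons.1 hx with rfl | hx
    · exact ⟨2, sq_smul_id_smulCone x _⟩
    · obtain ⟨n, hn⟩ := ih hx
      exact ⟨n * 2, by rw [pow_mul]; exact sq_smul_id_smulCone_of_smul_id _ _ _ hn⟩

lemma subsingleton_hom_smulCone_iff (x : R) :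
    Subsingleton (U ⟶ smulCone x V) ↔
      Function.Surjective (fun f : U ⟶ V ↦ x • f) ∧
        Function.Injective (fun f : U ⟶ V⟦(1 : ℤ)⟧ ↦ x • f) := by
  obtain ⟨g, h, hT, hg, hh⟩ := exists_smulCone_distinguished_smul_eq_zero x V
  refine ⟨fun hs ↦ ⟨fun f ↦ ?_, fun a b hab ↦ ?_⟩, fun ⟨h₁, h₂⟩ ↦ ⟨fun a b ↦ ?_⟩⟩
  · obtain ⟨u, hu⟩ : ∃ u : U ⟶ V, f = u ≫ (x • 𝟙 V) :=
      Triangle.coyoneda_exact₂ _ hT f (hs.elim _ _)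
    exact ⟨u, by rw [hu, Linear.comp_smul, Category.comp_id]⟩
  · have h0 : (a - b) ≫ (shiftFunctor C (1 : ℤ)).map (x • 𝟙 V) = 0 := by
      rw [Functor.map_smul, Functor.map_id, Linear.comp_smul, Category.comp_id, smul_sub,
        sub_eq_zero]
      exact hab
    obtain ⟨u, hu⟩ : ∃ u : U ⟶ smulCone x V, a - b = u ≫ h :=
      Triangle.coyoneda_exact₁ _ hT (a - b) h0
    rwa [hs.elim u 0, zero_comp, sub_eq_zero] at hu
  · have h0 : (a - b) ≫ h = 0 := h₂ (by
      simp only [← Linear.comp_smul, hh, comp_zero, smul_zero])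
    obtain ⟨u, hu⟩ : ∃ u : U ⟶ V, a - b = u ≫ g := Triangle.coyoneda_exact₃ _ hT (a - b) h0
    obtain ⟨v, rfl⟩ := h₁ u
    rwa [Linear.smul_comp, ← Linear.comp_smul, hg, comp_zero, sub_eq_zero] at hu

lemma subsingleton_smulCone_hom_iff (x : R) :
    Subsingleton (smulCone x U ⟶ V) ↔
      Function.Surjective (fun f : U⟦(1 : ℤ)⟧ ⟶ V ↦ x • f) ∧
        Function.Injective (fun f : U ⟶ V ↦ x • f) := by
  obtain ⟨g, h, hT, hg, hh⟩ := exists_smulCone_distinguished_smul_eq_zero x U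
  refine ⟨fun hs ↦ ⟨fun f ↦ ?_, fun a b hab ↦ ?_⟩, fun ⟨h₁, h₂⟩ ↦ ⟨fun a b ↦ ?_⟩⟩
  · obtain ⟨u, hu⟩ : ∃ u : U⟦(1 : ℤ)⟧ ⟶ V, f = (-(shiftFunctor C (1 : ℤ)).map (x • 𝟙 U)) ≫ u :=
      Triangle.yoneda_exact₃ _ (rot_of_distTriang _ hT) f (hs.elim _ _)
    refine ⟨-u, ?_⟩
    rw [hu, Functor.map_smul, Functor.map_id, Preadditive.neg_comp, Linear.smul_comp,
      Category.id_comp]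
    exact smul_neg x u
  · have h0 : (x • 𝟙 U) ≫ (a - b) = 0 := by
      rw [Linear.smul_comp, Category.id_comp, smul_sub, sub_eq_zero]
      exact hab
    obtain ⟨u, hu⟩ : ∃ u : smulCone x U ⟶ V, a - b = g ≫ u :=
      Triangle.yoneda_exact₂ _ hT (a - b) h0
    rwa [hs.elim u 0, comp_zero, sub_eq_zero] at hu
  · have h0 : g ≫ (a - b) = 0 := h₂ (by
      simp only [← Linear.smul_comp, hg, zero_comp, smul_zero])
    obtain ⟨u, hu⟩ : ∃ u : U⟦(1 : ℤ)⟧ ⟶ V, a - b = h ≫ u := Triangle.yoneda_exact₃ _ hT (a - b) h0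
    obtain ⟨v, rfl⟩ := h₁ u
    rwa [Linear.comp_smul, ← Linear.smul_comp, hh, zero_comp, sub_eq_zero] at hu

lemma homVanishes_smulCone_target_iff (x : R) {i j : ℤ} (h : i + 1 = j) :
    HomVanishes U (smulCone x V) i ↔
      Function.Surjective (fun f : U ⟶ V⟦i⟧ ↦ x • f) ∧
        Function.Injective (fun f : U ⟶ V⟦j⟧ ↦ x • f) := by
  rw [← subsingleton_shift_source (a := -i) (by lia), subsingleton_hom_smulCone_iff,
    (shiftSourceHomLinearEquiv R U V (-i) i (by lia)).smul_surjective_iff,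
    (shiftShiftHomLinearEquiv R U V (-i) 1 j (by lia)).smul_injective_iff]

lemma homVanishes_smulCone_source_iff (x : R) {i j : ℤ} (h : i + 1 = j) :
    HomVanishes (smulCone x U) V j ↔
      Function.Surjective (fun f : U ⟶ V⟦i⟧ ↦ x • f) ∧
        Function.Injective (fun f : U ⟶ V⟦j⟧ ↦ x • f) := by
  rw [HomVanishes, subsingleton_smulCone_hom_iff,
    (shiftShiftHomLinearEquiv R U V 1 j i h).smul_surjective_iff]

/-- The cone of multiplication by `x` is self-dual up to a shift. -/
lemma homVanishes_smulCone_comm (x : R) {i j : ℤ} (h : i + 1 = j) :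
    HomVanishes (smulCone x U) V j ↔ HomVanishes U (smulCone x V) i := by
  rw [homVanishes_smulCone_source_iff x h, homVanishes_smulCone_target_iff x h]

lemma homVanishes_koszul_comm (l : List R) (U V : C) {i j : ℤ} (h : i + l.length = j) :
    HomVanishes (koszul l U) V j ↔ HomVanishes U (koszul l.reverse V) i := by
  induction l generalizing V i j with
  | nil =>
    obtain rfl : i = j := by simpa using h
    rfl
  | cons x l ih =>
    rw [List.reverse_cons, koszul_concat, koszul_cons,
      homVanishes_smulCone_comm (i := j - 1) x (by lia), ih]
    rw [List.length_cons] at h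
    push_cast at h
    lia

lemma homVanishes_smulCone_target_iff_of_smul_id (x : R) (hx : x • 𝟙 U = 0) {i j : ℤ}
    (h : i + 1 = j) :
    HomVanishes U (smulCone x V) i ↔ HomVanishes U V i ∧ HomVanishes U V j := by
  have (n : ℤ) (f : U ⟶ V⟦n⟧) : x • f = 0 := by
    rw [← Category.id_comp f, ← Linear.smul_comp, hx, zero_comp]
  rw [homVanishes_smulCone_target_iff x h, homVanishes_iff_surjective_of_smul x (this i),
    homVanishes_iff_injective_of_smul x (this j)]

lemma homVanishes_smulCone_source_iff_of_smul_id (x : R) (hx : x • 𝟙 V = 0) {i j : ℤ}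
    (h : i + 1 = j) :
    HomVanishes (smulCone x U) V j ↔ HomVanishes U V i ∧ HomVanishes U V j := by
  have (n : ℤ) (f : U ⟶ V⟦n⟧) : x • f = 0 := by
    rw [← Category.comp_id f, ← Linear.comp_smul, ← Functor.map_id, ← Functor.map_smul, hx,
      Functor.map_zero, comp_zero]
  rw [homVanishes_smulCone_source_iff x h, homVanishes_iff_surjective_of_smul x (this i),
    homVanishes_iff_injective_of_smul x (this j)]

/-- `t` is the lowest degree in which there are nonzero morphisms from `U` to `V`. -/
def IsLowestHomDegree (U V : C) (t : ℤ) : Prop :=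
  (∀ i < t, HomVanishes U V i) ∧ ¬ HomVanishes U V t

lemma IsLowestHomDegree.of_koszul_target {l : List R} (hl : ∀ x ∈ l, x • 𝟙 U = 0) {t b : ℤ}
    (hb : IsLowestHomDegree U (koszul l V) b) (h : b + l.length = t) :
    IsLowestHomDegree U V t := by
  induction l generalizing b with
  | nil =>
    obtain rfl : b = t := by simpa using h
    exact hb
  | cons x l ih =>
    rw [List.forall_mem_cons] at hl
    rw [List.length_cons] at h
    push_cast at h
    rw [koszul_cons] at hb
    refine ih hl.2 (b := b + 1) ⟨fun i hi ↦ ?_, fun hV ↦ hb.2 ?_⟩ (by lia)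
    · exact ((homVanishes_smulCone_target_iff_of_smul_id x hl.1 (i := i - 1) (by lia)).1
        (hb.1 _ (by lia))).2
    · rw [homVanishes_smulCone_target_iff_of_smul_id x hl.1 rfl]
      exact ⟨((homVanishes_smulCone_target_iff_of_smul_id x hl.1 (i := b - 1) (by lia)).1
        (hb.1 _ (by lia))).2, hV⟩

lemma IsLowestHomDegree.of_koszul_source {l : List R} (hl : ∀ x ∈ l, x • 𝟙 V = 0) {w : ℤ}
    (hw : IsLowestHomDegree (koszul l U) V w) : IsLowestHomDegree U V w := by
  induction l with
  | nil => exact hw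
  | cons x l ih =>
    rw [List.forall_mem_cons] at hl
    have key (j : ℤ) := homVanishes_smulCone_source_iff_of_smul_id (U := koszul l U) x hl.1
      (sub_add_cancel j 1)
    have h1 (i : ℤ) (hi : i < w) : HomVanishes (koszul l U) V i := ((key i).1 (hw.1 i hi)).2
    exact ih hl.2 ⟨h1, fun h ↦ hw.2 ((key w).2 ⟨h1 _ (by lia), h⟩)⟩

lemma HomVanishes.of_koszul_source {l : List R} (hl : ∀ x ∈ l, x • 𝟙 V = 0)
    (h : ∀ i, HomVanishes (koszul l U) V i) (i : ℤ) : HomVanishes U V i := by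
  induction l generalizing i with
  | nil => exact h i
  | cons x l ih =>
    rw [List.forall_mem_cons] at hl
    exact ih hl.2 (fun i ↦ ((homVanishes_smulCone_source_iff_of_smul_id x hl.1
      (sub_add_cancel i 1)).1 (h i)).2) i

end Koszul

end CategoryTheory.Pretriangulated

namespace CategoryTheory.Pretriangulated

open Limits

variable {C : Type*} [Category C] [Preadditive C] [HasShift C ℤ]
  [∀ n : ℤ, (shiftFunctor C n).Additive] [HasZeroObject C] [Pretriangulated C]

lemma distinguished_of_iso_obj₁ {X X' Y Z : C} {f : X ⟶ Y} {g : Y ⟶ Z} {h : Z ⟶ X⟦(1 : ℤ)⟧}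
    (hT : Triangle.mk f g h ∈ distTriang C) (e : X ≅ X') :
    Triangle.mk (e.inv ≫ f) g (h ≫ e.hom⟦(1 : ℤ)⟧') ∈ distTriang C :=
  isomorphic_distinguished _ hT _ (Triangle.isoMk _ _ e.symm (Iso.refl Y) (Iso.refl Z)
    (Category.comp_id (e.inv ≫ f)) ((Category.comp_id g).trans (Category.id_comp g).symm) (by
      change (h ≫ e.hom⟦(1 : ℤ)⟧') ≫ e.inv⟦(1 : ℤ)⟧' = 𝟙 Z ≫ h
      simp [← Functor.map_comp]))

lemma distinguished_of_iso_obj₃ {X Y Z Z' : C} {f : X ⟶ Y} {g : Y ⟶ Z} {h : Z ⟶ X⟦(1 : ℤ)⟧}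
    (hT : Triangle.mk f g h ∈ distTriang C) (e : Z ≅ Z') :
    Triangle.mk f (g ≫ e.hom) (e.inv ≫ h) ∈ distTriang C :=
  isomorphic_distinguished _ hT _ (Triangle.isoMk _ _ (Iso.refl X) (Iso.refl Y) e.symm
    ((Category.comp_id f).trans (Category.id_comp f).symm) (by
      change (g ≫ e.hom) ≫ e.inv = 𝟙 Y ≫ g
      simp) (by
      change (e.inv ≫ h) ≫ (𝟙 X)⟦(1 : ℤ)⟧' = e.inv ≫ h
      simp))

end CategoryTheory.Pretriangulated

namespace DerivedCategory

open Limits Pretriangulated HomologySequence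

universe w' w v u

variable {C : Type u} [Category.{v} C] [Abelian C] [HasDerivedCategory.{w} C]

lemma isZero_homology_obj₃ {T : Triangle (DerivedCategory C)} (hT : T ∈ distTriang _) {i j : ℤ}
    (hij : i + 1 = j) (h₂ : IsZero ((homologyFunctor C i).obj T.obj₂))
    (h₁ : IsZero ((homologyFunctor C j).obj T.obj₁)) :
    IsZero ((homologyFunctor C i).obj T.obj₃) :=
  (exact₃ T hT i j hij).isZero_of_both_zeros (h₂.eq_of_src _ _) (h₁.eq_of_tgt _ _)

lemma isZero_homology_obj₁ {T : Triangle (DerivedCategory C)} (hT : T ∈ distTriang _) {i j : ℤ}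
    (hij : i + 1 = j) (h₃ : IsZero ((homologyFunctor C i).obj T.obj₃))
    (h₂ : IsZero ((homologyFunctor C j).obj T.obj₂)) :
    IsZero ((homologyFunctor C j).obj T.obj₁) :=
  (exact₁ T hT i j hij).isZero_of_both_zeros (h₃.eq_of_src _ _) (h₂.eq_of_tgt _ _)

lemma isIso_homologyMap_mor₁ {T : Triangle (DerivedCategory C)} (hT : T ∈ distTriang _) {i j : ℤ}
    (hij : i + 1 = j) (h : IsZero ((homologyFunctor C i).obj T.obj₃))
    (h' : IsZero ((homologyFunctor C j).obj T.obj₃)) :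
    IsIso ((homologyFunctor C j).map T.mor₁) := by
  have := (mono_homologyMap_mor₁_iff T hT i j hij).2 (h.eq_of_src _ _)
  have := (epi_homologyMap_mor₁_iff T hT j).2 (h'.eq_of_tgt _ _)
  exact isIso_of_mono_of_epi _

lemma isIso_homologyMap_mor₂ {T : Triangle (DerivedCategory C)} (hT : T ∈ distTriang _) {i j : ℤ}
    (hij : i + 1 = j) (h : IsZero ((homologyFunctor C i).obj T.obj₁))
    (h' : IsZero ((homologyFunctor C j).obj T.obj₁)) :
    IsIso ((homologyFunctor C i).map T.mor₂) := by
  have := (epi_homologyMap_mor₂_iff T hT i j hij).2 (h'.eq_of_tgt _ _)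
  have := (mono_homologyMap_mor₂_iff T hT i).2 (h.eq_of_src _ _)
  exact isIso_of_mono_of_epi _

lemma exists_iso_singleFunctor_homology (X : DerivedCategory C) (n : ℤ) [X.IsGE n] [X.IsLE n] :
    Nonempty (X ≅ (singleFunctor C n).obj ((homologyFunctor C n).obj X)) := by
  obtain ⟨Y, ⟨e⟩⟩ := exists_iso_singleFunctor_obj_of_isGE_of_isLE X n
  exact ⟨e ≪≫ (singleFunctor C n).mapIso
    (((singleFunctorCompHomologyFunctorIso C n).app Y).symm ≪≫
      (homologyFunctor C n).mapIso e.symm)⟩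

/-- The truncation triangle splitting off the lowest homology object. -/
lemma exists_triangle_of_isGE (X : DerivedCategory C) (b : ℤ) [X.IsGE b] :
    ∃ (X' : DerivedCategory C) (_ : X'.IsGE (b + 1))
      (_ : ∀ j, b < j → Nonempty ((homologyFunctor C j).obj X ≅ (homologyFunctor C j).obj X'))
      (f : (singleFunctor C b).obj ((homologyFunctor C b).obj X) ⟶ X) (g : X ⟶ X')
      (h : X' ⟶ ((singleFunctor C b).obj ((homologyFunctor C b).obj X))⟦(1 : ℤ)⟧),
      Triangle.mk f g h ∈ distTriang _ := by
  obtain ⟨X₀, X₁, h₀, h₁, f, g, h, hT⟩ := TStructure.t.exists_triangle X b (b + 1) rfl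
  have hX₀ : X₀.IsLE b := ⟨h₀⟩
  have hX₁ : X₁.IsGE (b + 1) := ⟨h₁⟩
  have hX₀' : X₀.IsGE b := (isGE_iff _ _).2 fun i hi ↦
    isZero_homology_obj₁ hT (sub_add_cancel i 1) (isZero_of_isGE X₁ (b + 1) _ (by lia))
      (isZero_of_isGE X b i hi)
  have : IsIso ((homologyFunctor C b).map f) := isIso_homologyMap_mor₁ hT (sub_add_cancel b 1)
    (isZero_of_isGE X₁ (b + 1) _ (by lia)) (isZero_of_isGE X₁ (b + 1) _ (by lia))
  obtain ⟨e₀⟩ := exists_iso_singleFunctor_homology X₀ b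
  let e := e₀ ≪≫ (singleFunctor C b).mapIso (asIso ((homologyFunctor C b).map f))
  refine ⟨X₁, hX₁, fun j hj ↦ ?_, e.inv ≫ f, g, h ≫ e.hom⟦(1 : ℤ)⟧',
    distinguished_of_iso_obj₁ hT e⟩
  have : IsIso ((homologyFunctor C j).map g) := isIso_homologyMap_mor₂ hT rfl
    (isZero_of_isLE X₀ b _ (by lia)) (isZero_of_isLE X₀ b _ (by lia))
  exact ⟨asIso ((homologyFunctor C j).map g)⟩

/-- The truncation triangle splitting off the highest homology object. -/
lemma exists_triangle_of_isLE (X : DerivedCategory C) (c : ℤ) [X.IsLE c] :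
    ∃ (X' : DerivedCategory C) (_ : X'.IsLE (c - 1)) (f : X' ⟶ X)
      (g : X ⟶ (singleFunctor C c).obj ((homologyFunctor C c).obj X))
      (h : (singleFunctor C c).obj ((homologyFunctor C c).obj X) ⟶ X'⟦(1 : ℤ)⟧),
      Triangle.mk f g h ∈ distTriang _ := by
  obtain ⟨X₀, X₁, h₀, h₁, f, g, h, hT⟩ := TStructure.t.exists_triangle X (c - 1) c (by lia)
  have hX₀ : X₀.IsLE (c - 1) := ⟨h₀⟩
  have hX₁ : X₁.IsGE c := ⟨h₁⟩
  have hX₁' : X₁.IsLE c := (isLE_iff _ _).2 fun i hi ↦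
    isZero_homology_obj₃ hT rfl (isZero_of_isLE X c i hi)
      (isZero_of_isLE X₀ (c - 1) _ (by lia))
  have : IsIso ((homologyFunctor C c).map g) := isIso_homologyMap_mor₂ hT rfl
    (isZero_of_isLE X₀ (c - 1) _ (by lia)) (isZero_of_isLE X₀ (c - 1) _ (by lia))
  obtain ⟨e₀⟩ := exists_iso_singleFunctor_homology X₁ c
  let e := e₀ ≪≫ (singleFunctor C c).mapIso (asIso ((homologyFunctor C c).map g)).symm
  exact ⟨X₀, hX₀, f, g ≫ e.hom, e.inv ≫ h,
    distinguished_of_iso_obj₃ hT e⟩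

lemma homVanishes_of_isLE_of_isGE (X Y : DerivedCategory C) (a b : ℤ) [X.IsLE a] [Y.IsGE b]
    {i : ℤ} (h : a + i < b) : HomVanishes X Y i :=
  have : (Y⟦i⟧).IsGE (b - i) := TStructure.t.isGE_shift Y b i (b - i)
  homVanishes_of_forall fun f ↦ TStructure.t.zero f a (b - i)

lemma homVanishes_singleFunctor_source {L : C} {Y : DerivedCategory C} {b i j : ℤ}
    (h : i + b = j) :
    HomVanishes ((singleFunctor C b).obj L) Y i ↔ HomVanishes ((singleFunctor C 0).obj L) Y j := by
  rw [← homVanishes_iff_of_iso (((singleFunctors C).shiftIso (-b) b 0 (by lia)).app L)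
    (Iso.refl Y)]
  exact homVanishes_shift_source (by lia)

lemma homVanishes_singleFunctor_target {L : C} {X : DerivedCategory C} {b i j : ℤ}
    (h : j + b = i) :
    HomVanishes X ((singleFunctor C b).obj L) i ↔ HomVanishes X ((singleFunctor C 0).obj L) j := by
  rw [← homVanishes_iff_of_iso (Iso.refl X)
    (((singleFunctors C).shiftIso (-b) b 0 (by lia)).app L)]
  exact homVanishes_shift_target (by lia)

lemma homVanishes_singleFunctor_zero {K L : C} :
    HomVanishes ((singleFunctor C 0).obj K) ((singleFunctor C 0).obj L) 0 ↔
      Subsingleton (K ⟶ L) :=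
  homVanishes_zero.trans
    (Functor.FullyFaithful.ofFullyFaithful (singleFunctor C 0)).homEquiv.symm.subsingleton_congr

lemma homVanishes_singleFunctor_natCast [HasExt.{w'} C] {K L : C} {n : ℕ} :
    HomVanishes ((singleFunctor C 0).obj K) ((singleFunctor C 0).obj L) n ↔
      Subsingleton (Abelian.Ext.{w'} K L n) :=
  Abelian.Ext.homEquiv.symm.subsingleton_congr

lemma homVanishes_singleFunctor_of_neg {K L : C} {i : ℤ} (hi : i < 0) :
    HomVanishes ((singleFunctor C 0).obj K) ((singleFunctor C 0).obj L) i :=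
  homVanishes_of_isLE_of_isGE _ _ 0 0 (by lia)

lemma homVanishes_iff_of_isGE (K : C) (W : DerivedCategory C) (b : ℤ) [W.IsGE b] :
    HomVanishes ((singleFunctor C 0).obj K) W b ↔
      Subsingleton (K ⟶ (homologyFunctor C b).obj W) := by
  obtain ⟨W', hW', -, f, g, h, hT⟩ := exists_triangle_of_isGE W b
  rw [← homVanishes_singleFunctor_zero, ← homVanishes_singleFunctor_target (i := b) (b := b)
    (by lia)]
  exact ⟨fun hW ↦ HomVanishes.obj₁_target_of_obj₂ hT (sub_add_cancel b 1) hW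
      (homVanishes_of_isLE_of_isGE ((singleFunctor C 0).obj K) W' 0 (b + 1) (by lia)),
    fun hL ↦ HomVanishes.obj₂_target hT hL
      (homVanishes_of_isLE_of_isGE ((singleFunctor C 0).obj K) W' 0 (b + 1) (by lia))⟩

lemma homVanishes_iff_of_isLE (K : C) (Y : DerivedCategory C) (c : ℤ) [Y.IsLE c] :
    HomVanishes Y ((singleFunctor C 0).obj K) (-c) ↔
      Subsingleton ((homologyFunctor C c).obj Y ⟶ K) := by
  obtain ⟨Y', hY', f, g, h, hT⟩ := exists_triangle_of_isLE Y c
  rw [← homVanishes_singleFunctor_zero, ← homVanishes_singleFunctor_source (i := -c) (b := c)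
    (by lia)]
  exact ⟨fun hW ↦ HomVanishes.obj₃_source hT (sub_add_cancel (-c) 1) hW
      (homVanishes_of_isLE_of_isGE Y' ((singleFunctor C 0).obj K) (c - 1) 0 (by lia)),
    fun hL ↦ HomVanishes.obj₂_source hT
      (homVanishes_of_isLE_of_isGE Y' ((singleFunctor C 0).obj K) (c - 1) 0 (by lia)) hL⟩

lemma isLowestHomDegree_of_isGE (K : C) (W : DerivedCategory C) (b : ℤ) [W.IsGE b]
    (h : Nontrivial (K ⟶ (homologyFunctor C b).obj W)) :
    IsLowestHomDegree ((singleFunctor C 0).obj K) W b :=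
  ⟨fun _ _ ↦ homVanishes_of_isLE_of_isGE _ _ 0 b (by lia), by
    rwa [homVanishes_iff_of_isGE, not_subsingleton_iff_nontrivial]⟩

lemma isLowestHomDegree_of_isLE (K : C) (Y : DerivedCategory C) (c : ℤ) [Y.IsLE c]
    (h : Nontrivial ((homologyFunctor C c).obj Y ⟶ K)) :
    IsLowestHomDegree Y ((singleFunctor C 0).obj K) (-c) :=
  ⟨fun _ _ ↦ homVanishes_of_isLE_of_isGE _ _ c 0 (by lia), by
    rwa [homVanishes_iff_of_isLE, not_subsingleton_iff_nontrivial]⟩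

lemma homVanishes_of_projective (P : C) [Projective P] (X : DerivedCategory C) (c : ℤ) [X.IsLE c]
    {i : ℤ} (h : c < i) : HomVanishes ((singleFunctor C 0).obj P) X i := by
  rw [← homVanishes_singleFunctor_source (i := 0) (b := i) (by lia), homVanishes_zero]
  obtain ⟨L, hL, ⟨e⟩⟩ := exists_iso_Q_obj_of_isLE X c
  have key (φ : (singleFunctor C i).obj P ⟶ Q.obj L) : φ = 0 :=
    from_singleFunctor_obj_eq_zero_of_projective φ c h
  refine ⟨fun f g ↦ ?_⟩
  rw [← cancel_mono e.hom, key (f ≫ e.hom), key (g ≫ e.hom)]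

lemma homVanishes_projective_iff (P : C) [Projective P] (X : DerivedCategory C) (i : ℤ) :
    HomVanishes ((singleFunctor C 0).obj P) X i ↔
      Subsingleton (P ⟶ (homologyFunctor C i).obj X) := by
  obtain ⟨X₀, X₁, h₀, h₁, f, g, h, hT⟩ := TStructure.t.exists_triangle X (i - 1) i (by lia)
  have hX₀ : X₀.IsLE (i - 1) := ⟨h₀⟩
  have hX₁ : X₁.IsGE i := ⟨h₁⟩
  have : IsIso ((homologyFunctor C i).map g) := isIso_homologyMap_mor₂ hT rfl
    (isZero_of_isLE X₀ (i - 1) _ (by lia)) (isZero_of_isLE X₀ (i - 1) _ (by lia))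
  rw [(Iso.homCongr (Iso.refl P) (asIso ((homologyFunctor C i).map g))).subsingleton_congr,
    ← homVanishes_iff_of_isGE]
  exact ⟨fun hX ↦ HomVanishes.obj₃_target hT rfl hX
      (homVanishes_of_projective P X₀ (i - 1) (by lia)),
    fun h₁ ↦ HomVanishes.obj₂_target hT (homVanishes_of_projective P X₀ (i - 1) (by lia)) h₁⟩

lemma isZero_iff (X : DerivedCategory C) :
    IsZero X ↔ ∀ i, IsZero ((homologyFunctor C i).obj X) := by
  refine ⟨fun h i ↦ (homologyFunctor C i).map_isZero h, fun h ↦ ?_⟩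
  have : X.IsLE 0 := (isLE_iff _ _).2 fun i _ ↦ h i
  have : X.IsGE 1 := (isGE_iff _ _).2 fun i _ ↦ h i
  exact TStructure.t.isZero X 0 1

section Linear

variable {R : Type*} [CommRing R] [Linear R C]

instance (n : ℤ) : (homologyFunctor C n).Linear R := by
  have : (HomologicalComplex.homologyFunctor C (ComplexShape.up ℤ) n).Linear R :=
    ⟨fun f r ↦ ShortComplex.homologyMap_smul
      ((HomologicalComplex.shortComplexFunctor C (ComplexShape.up ℤ) n).map f) r⟩
  have : (Q ⋙ homologyFunctor C n).Linear R :=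
    Functor.linear_of_iso _ (homologyFunctorFactors C n).symm
  have : Localization.Lifting Q (HomologicalComplex.quasiIso C (ComplexShape.up ℤ))
    (Q ⋙ homologyFunctor C n) (homologyFunctor C n) := ⟨Iso.refl _⟩
  exact (Localization.functor_linear_iff Q (HomologicalComplex.quasiIso C (ComplexShape.up ℤ)) R
    (Q ⋙ homologyFunctor C n) (homologyFunctor C n)).1 ‹_›

lemma isLE_smulCone (x : R) (X : DerivedCategory C) (c : ℤ) [X.IsLE c] :
    (smulCone x X).IsLE c := by
  obtain ⟨g, h, hT⟩ := exists_smulCone_distinguished x X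
  exact (isLE_iff _ _).2 fun i hi ↦ isZero_homology_obj₃ hT rfl (isZero_of_isLE X c i hi)
    (isZero_of_isLE X c _ (by lia))

lemma isGE_smulCone (x : R) (X : DerivedCategory C) (b : ℤ) [X.IsGE b] :
    (smulCone x X).IsGE (b - 1) := by
  obtain ⟨g, h, hT⟩ := exists_smulCone_distinguished x X
  exact (isGE_iff _ _).2 fun i hi ↦ isZero_homology_obj₃ hT rfl (isZero_of_isGE X b i (by lia))
    (isZero_of_isGE X b _ (by lia))

lemma isLE_koszul (l : List R) (X : DerivedCategory C) (c : ℤ) [hX : X.IsLE c] :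
    (koszul l X).IsLE c := by
  induction l with
  | nil => exact hX
  | cons x l ih => exact isLE_smulCone x (koszul l X) c

lemma isGE_koszul (l : List R) (X : DerivedCategory C) (b : ℤ) [hX : X.IsGE b] :
    (koszul l X).IsGE (b - l.length) := by
  induction l with
  | nil => exact (sub_zero b).symm ▸ hX
  | cons x l ih =>
    rw [List.length_cons, Nat.cast_succ, ← sub_sub]
    exact isGE_smulCone x (koszul l X) _

end Linear

end DerivedCategory

lemma Module.nontrivial_linearMap_of_isScalarTower {A K V : Type*} [CommRing A] [Field K]
    [Algebra A K] [AddCommGroup V] [Module A V] [Module K V] [IsScalarTower A K V] [Nontrivial V] :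
    Nontrivial (V →ₗ[A] K) := by
  obtain ⟨φ, hφ⟩ := exists_ne (0 : Module.Dual K V)
  exact ⟨φ.restrictScalars A, 0, fun h ↦ hφ (LinearMap.restrictScalars_injective A h)⟩

lemma CategoryTheory.ShortComplex.Exact.isNoetherian_moduleCat {A : Type*} [Ring A]
    {S : ShortComplex (ModuleCat A)} (hS : S.Exact) (h₁ : IsNoetherian A S.X₁)
    (h₃ : IsNoetherian A S.X₃) : IsNoetherian A S.X₂ :=
  isNoetherian_of_range_eq_ker _ _ hS.moduleCat_range_eq_ker

namespace IsLocalRing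

variable {A : Type} [CommRing A] [IsLocalRing A]

lemma exists_injective_residueField [IsNoetherianRing A] {L : Type} [AddCommGroup L] [Module A L]
    [Nontrivial L] {N : ℕ} (hN : maximalIdeal A ^ N ≤ Module.annihilator A L) :
    ∃ f : ResidueField A →ₗ[A] L, Function.Injective f := by
  obtain ⟨p, hp⟩ := associatedPrimes.nonempty A L
  have hp' := hp.isPrime
  obtain rfl : p = maximalIdeal A :=
    (((maximalIdeal.isMaximal A).eq_of_le hp.isPrime.ne_top
      (hp'.le_of_pow_le (hN.trans (Submodule.annihilator_top.ge.trans hp.annihilator_le))))).symm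
  exact ((isAssociatedPrime_iff_exists_injective_linearMap _ _).1 hp).2

lemma nontrivial_linearMap_residueField {L : Type} [AddCommGroup L] [Module A L]
    [Nontrivial L] {N : ℕ} (hN : maximalIdeal A ^ N ≤ Module.annihilator A L) :
    Nontrivial (L →ₗ[A] ResidueField A) := by
  have hne : maximalIdeal A • (⊤ : Submodule A L) ≠ ⊤ := fun h ↦ by
    have hpow (n : ℕ) : maximalIdeal A ^ n • (⊤ : Submodule A L) = ⊤ := by
      induction n with
      | zero => simp
      | succ n ih => rw [pow_succ, Submodule.mul_smul, h, ih]
    refine (bot_ne_top (α := Submodule A L)) ?_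
    rw [← hpow N, eq_comm, eq_bot_iff, Submodule.smul_le]
    intro r hr x _
    simpa using Module.mem_annihilator.1 (hN hr) x
  have : Nontrivial (L ⧸ maximalIdeal A • (⊤ : Submodule A L)) :=
    Submodule.Quotient.nontrivial_iff.2 hne
  let : Module (ResidueField A) (L ⧸ maximalIdeal A • (⊤ : Submodule A L)) :=
    inferInstanceAs (Module (A ⧸ maximalIdeal A) _)
  have : IsScalarTower A (ResidueField A) (L ⧸ maximalIdeal A • (⊤ : Submodule A L)) :=
    inferInstanceAs (IsScalarTower A (A ⧸ maximalIdeal A) _)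
  have := Module.nontrivial_linearMap_of_isScalarTower (A := A) (K := ResidueField A)
    (V := L ⧸ maximalIdeal A • (⊤ : Submodule A L))
  obtain ⟨φ, hφ⟩ := exists_ne
    (0 : (L ⧸ maximalIdeal A • (⊤ : Submodule A L)) →ₗ[A] ResidueField A)
  exact ⟨φ ∘ₗ Submodule.mkQ _, 0, fun h ↦ hφ (Submodule.linearMap_qext _ h)⟩

end IsLocalRing

namespace DerivedCategory

open Limits Pretriangulated HomologySequence IsLocalRing

universe w

section Homology

variable {A : Type} [CommRing A] [HasDerivedCategory.{w} (ModuleCat.{0} A)]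

lemma exists_pow_le_annihilator_homology_koszul {l : List A} {I : Ideal A} (hI : I.FG)
    (hl : Ideal.ofList l = I) (X : DerivedCategory (ModuleCat.{0} A)) (j : ℤ) :
    ∃ N : ℕ, I ^ N ≤
      Module.annihilator A ((homologyFunctor (ModuleCat.{0} A) j).obj (koszul l X)) := by
  refine Ideal.exists_pow_le_of_le_radical_of_fg ?_ hI
  rw [← hl, Ideal.ofList, Ideal.span_le]
  intro x hx
  obtain ⟨n, hn⟩ := exists_pow_smul_id_koszul l X x hx
  refine ⟨n, Module.mem_annihilator.2 fun y ↦ ?_⟩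
  have h := congr((homologyFunctor (ModuleCat.{0} A) j).map $hn)
  rw [CategoryTheory.Functor.map_smul, CategoryTheory.Functor.map_id,
    Functor.map_zero] at h
  exact congr($(h).hom y)

lemma finite_homology_smulCone [IsNoetherianRing A] {X : DerivedCategory (ModuleCat.{0} A)} (x : A)
    (hX : ∀ j, Module.Finite A ((homologyFunctor (ModuleCat.{0} A) j).obj X)) (j : ℤ) :
    Module.Finite A ((homologyFunctor (ModuleCat.{0} A) j).obj (smulCone x X)) := by
  obtain ⟨g, h, hT⟩ := exists_smulCone_distinguished x X
  have (i : ℤ) : IsNoetherian A ((homologyFunctor (ModuleCat.{0} A) i).obj X) :=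
    have := hX i
    isNoetherian_of_isNoetherianRing_of_finite A _
  have : IsNoetherian A ((homologyFunctor (ModuleCat.{0} A) j).obj (smulCone x X)) :=
    (exact₃ _ hT j _ rfl).isNoetherian_moduleCat (this j) (this (j + 1))
  exact Module.IsNoetherian.finite A _

lemma finite_homology_koszul [IsNoetherianRing A] {X : DerivedCategory (ModuleCat.{0} A)}
    (l : List A) (hX : ∀ j, Module.Finite A ((homologyFunctor (ModuleCat.{0} A) j).obj X)) (j : ℤ) :
    Module.Finite A ((homologyFunctor (ModuleCat.{0} A) j).obj (koszul l X)) := by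
  induction l generalizing j with
  | nil => exact hX j
  | cons x l ih => exact finite_homology_smulCone x ih j

lemma finite_homology_singleFunctor (L : ModuleCat.{0} A) [Module.Finite A L] (j : ℤ) :
    Module.Finite A ((homologyFunctor (ModuleCat.{0} A) j).obj
      ((singleFunctor (ModuleCat.{0} A) 0).obj L)) := by
  rcases lt_trichotomy j 0 with h | rfl | h
  · have := ModuleCat.isZero_iff_subsingleton.1
      (isZero_of_isGE ((singleFunctor (ModuleCat.{0} A) 0).obj L) 0 j h)
    infer_instance
  · have : Module.Finite A ((𝟭 (ModuleCat.{0} A)).obj L) := ‹_›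
    exact Module.Finite.equiv
      ((singleFunctorCompHomologyFunctorIso (ModuleCat.{0} A) 0).app L).symm.toLinearEquiv
  · have := ModuleCat.isZero_iff_subsingleton.1
      (isZero_of_isLE ((singleFunctor (ModuleCat.{0} A) 0).obj L) 0 j h)
    infer_instance

end Homology

/-- The residue field of `A`, as a complex concentrated in degree `0`. -/
abbrev residueComplex (A : Type) [CommRing A] [IsLocalRing A]
    [HasDerivedCategory.{w} (ModuleCat.{0} A)] : DerivedCategory (ModuleCat.{0} A) :=
  (singleFunctor (ModuleCat.{0} A) 0).obj (residueModule A)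

lemma smul_id_residueComplex {A : Type} [CommRing A] [IsLocalRing A]
    [HasDerivedCategory.{w} (ModuleCat.{0} A)] {x : A} (hx : x ∈ maximalIdeal A) :
    x • 𝟙 (residueComplex A) = 0 := by
  have h : x • 𝟙 (residueModule A) = 0 := by
    ext y
    have : x ∈ Module.annihilator A (ResidueField A) := by
      rwa [show Module.annihilator A (ResidueField A) = maximalIdeal A from
        Ideal.annihilator_quotient]
    exact Module.mem_annihilator.1 this y
  rw [← CategoryTheory.Functor.map_id, ← CategoryTheory.Functor.map_smul, h, Functor.map_zero]

lemma exists_triangle_of_homology_isFinitePowTorsion {A : Type} [CommRing A] [IsLocalRing A]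
    [HasDerivedCategory.{w} (ModuleCat.{0} A)] (X : DerivedCategory (ModuleCat.{0} A)) (b c : ℤ)
    [X.IsGE b] [X.IsLE c] (hX : ∀ j, Module.IsFinitePowTorsion (maximalIdeal A)
      ((homologyFunctor (ModuleCat.{0} A) j).obj X)) :
    ∃ (X' : DerivedCategory (ModuleCat.{0} A)) (_ : X'.IsGE (b + 1)) (_ : X'.IsLE c)
      (_ : ∀ j, Module.IsFinitePowTorsion (maximalIdeal A)
        ((homologyFunctor (ModuleCat.{0} A) j).obj X'))
      (f : (singleFunctor (ModuleCat.{0} A) b).obj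
        ((homologyFunctor (ModuleCat.{0} A) b).obj X) ⟶ X) (g : X ⟶ X')
      (h : X' ⟶ ((singleFunctor (ModuleCat.{0} A) b).obj
        ((homologyFunctor (ModuleCat.{0} A) b).obj X))⟦(1 : ℤ)⟧),
      Triangle.mk f g h ∈ distTriang _ := by
  obtain ⟨X', hX', e, f, g, δ, hT⟩ := exists_triangle_of_isGE X b
  refine ⟨X', hX', (isLE_iff _ _).2 fun j hj ↦ ?_, fun j ↦ ?_, f, g, δ, hT⟩
  · by_cases hbj : b < j
    · exact (isZero_of_isLE X c j hj).of_iso (e j hbj).some.symm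
    · exact isZero_of_isGE X' (b + 1) j (by lia)
  · by_cases hbj : b < j
    · let e' := (e j hbj).some.toLinearEquiv
      exact (hX j).of_surjective e'.toLinearMap e'.surjective
    · have := ModuleCat.isZero_iff_subsingleton.1 (isZero_of_isGE X' (b + 1) j (by lia))
      exact ⟨inferInstance, 0, by rw [Module.annihilator_eq_top_iff.2 this]; exact le_top⟩

section Devissage

variable {A : Type} [CommRing A] [IsNoetherianRing A] [IsLocalRing A]
  [HasDerivedCategory.{w} (ModuleCat.{0} A)]

variable {N X : DerivedCategory (ModuleCat.{0} A)}

lemma homVanishes_of_isFinitePowTorsion {i : ℤ} (h : HomVanishes (residueComplex A) N i)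
    (L : Type) [AddCommGroup L] [Module A L] (hL : Module.IsFinitePowTorsion (maximalIdeal A) L) :
    HomVanishes ((singleFunctor (ModuleCat.{0} A) 0).obj (ModuleCat.of A L)) N i := by
  refine devissage (P := fun L ↦ HomVanishes ((singleFunctor (ModuleCat.{0} A) 0).obj L) N i)
    ?_ ?_ ?_ L hL
  · intro L hL
    exact homVanishes_of_forall
      fun f ↦ ((singleFunctor (ModuleCat.{0} A) 0).map_isZero hL).eq_of_src _ _
  · rintro L ⟨e⟩
    exact h.of_iso ((singleFunctor _ 0).mapIso e.symm) (Iso.refl N)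
  · intro S hS h₁ h₃
    exact HomVanishes.obj₂_source hS.singleTriangle_distinguished h₁ h₃

lemma homVanishes_of_homology_isFinitePowTorsion {b c : ℤ} [X.IsGE b] [X.IsLE c] {i : ℤ}
    (hX : ∀ j, Module.IsFinitePowTorsion (maximalIdeal A)
      ((homologyFunctor (ModuleCat.{0} A) j).obj X))
    (h : ∀ j, b ≤ j → HomVanishes (residueComplex A) N (i + j)) : HomVanishes X N i := by
  obtain ⟨n, hn⟩ : ∃ n : ℕ, c < b + n := ⟨(c - b + 1).toNat, by lia⟩
  induction n generalizing X b with
  | zero =>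
    exact homVanishes_of_forall fun f ↦
      (TStructure.t.isZero X c b (by simpa using hn)).eq_of_src _ _
  | succ n ih =>
    obtain ⟨X', hX', hX'', hX₁, f, g, δ, hT⟩ :=
      exists_triangle_of_homology_isFinitePowTorsion X b c hX
    refine HomVanishes.obj₂_source hT ?_ ?_
    · exact (homVanishes_singleFunctor_source rfl).2
        (homVanishes_of_isFinitePowTorsion (h b le_rfl) _ (hX b))
    · exact ih (X := X') (b := b + 1) hX₁ (fun j hj ↦ h j (by lia)) (by push_cast at hn; lia)

lemma not_homVanishes_of_homology_isFinitePowTorsion {b c : ℤ} [X.IsGE b] [X.IsLE c] {s : ℤ}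
    (hX : ∀ j, Module.IsFinitePowTorsion (maximalIdeal A)
      ((homologyFunctor (ModuleCat.{0} A) j).obj X))
    (hb : Nontrivial ((homologyFunctor (ModuleCat.{0} A) b).obj X))
    (h : ∀ i, s < i → HomVanishes (residueComplex A) N i)
    (hs : ¬ HomVanishes (residueComplex A) N s) : ¬ HomVanishes X N (s - b) := by
  intro hv
  obtain ⟨X', hX', hX'', hX₁, f, g, δ, hT⟩ :=
    exists_triangle_of_homology_isFinitePowTorsion X b c hX
  have hL := HomVanishes.obj₁_source_of_obj₂ hT rfl hv
    (homVanishes_of_homology_isFinitePowTorsion (X := X') (b := b + 1) (c := c) hX₁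
      fun j hj ↦ h _ (by lia))
  replace hL := (homVanishes_singleFunctor_source (sub_add_cancel s b)).1 hL
  obtain ⟨r, hr⟩ := (hX b).exists_pow_le
  obtain ⟨u, hu⟩ := exists_injective_residueField hr
  have hS : (ShortComplex.mk (ModuleCat.ofHom u) (ModuleCat.ofHom (LinearMap.range u).mkQ)
      (by ext x; simp)).ShortExact :=
    ModuleCat.shortComplex_shortExact _ (LinearMap.exact_map_mkQ_range u) hu
      (Submodule.mkQ_surjective _)
  exact hs (HomVanishes.obj₁_source_of_obj₂ hS.singleTriangle_distinguished rfl hL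
    (homVanishes_of_isFinitePowTorsion (h (s + 1) (by lia)) _
      ((hX b).of_surjective _ (Submodule.mkQ_surjective _))))

end Devissage

end DerivedCategory

section

namespace DerivedCategory

open Limits Pretriangulated HomologySequence IsLocalRing

universe w

variable {A : Type} [CommRing A] [IsNoetherianRing A] [IsLocalRing A]
  [HasDerivedCategory.{w} (ModuleCat.{0} A)]

/-- The ring `A`, as a complex concentrated in degree `0`. -/
abbrev ringComplex (A : Type) [CommRing A] [HasDerivedCategory.{w} (ModuleCat.{0} A)] :
    DerivedCategory (ModuleCat.{0} A) :=
  (singleFunctor (ModuleCat.{0} A) 0).obj (ModuleCat.of A A)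

lemma homVanishes_ringComplex_iff {A : Type} [CommRing A] [HasDerivedCategory.{w} (ModuleCat.{0} A)]
    (X : DerivedCategory (ModuleCat.{0} A)) (i : ℤ) :
    HomVanishes (ringComplex A) X i ↔
      Subsingleton ((homologyFunctor (ModuleCat.{0} A) i).obj X) := by
  rw [homVanishes_projective_iff]
  exact (ModuleCat.homEquiv.trans (LinearMap.ringLmapEquivSelf A ℕ _).toEquiv).subsingleton_congr

lemma smul_id_residueComplex_of_mem {A : Type} [CommRing A] [IsLocalRing A]
    [HasDerivedCategory.{w} (ModuleCat.{0} A)] {l : List A}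
    (hl : Ideal.ofList l = maximalIdeal A) {x : A} (hx : x ∈ l) : x • 𝟙 (residueComplex A) = 0 :=
  smul_id_residueComplex (hl ▸ Ideal.subset_span hx)

section Koszul

variable {l : List A}

lemma homology_koszul_ringComplex_isFinitePowTorsion (hl : Ideal.ofList l = maximalIdeal A)
    (j : ℤ) : Module.IsFinitePowTorsion (maximalIdeal A)
      ((homologyFunctor (ModuleCat.{0} A) j).obj (koszul l (ringComplex A))) :=
  ⟨finite_homology_koszul l (fun i ↦ finite_homology_singleFunctor (ModuleCat.of A A) i) j,
    exists_pow_le_annihilator_homology_koszul (IsNoetherian.noetherian _) hl _ j⟩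

/-- The Koszul complex on generators of the maximal ideal has a lowest nonzero homology object. -/
lemma exists_lowest_homology_koszul_ringComplex {A : Type} [CommRing A] [IsLocalRing A]
    [HasDerivedCategory.{w} (ModuleCat.{0} A)] {l : List A} (hl : Ideal.ofList l = maximalIdeal A) :
    ∃ b : ℤ, (koszul l (ringComplex A)).IsGE b ∧
      Nontrivial ((homologyFunctor (ModuleCat.{0} A) b).obj (koszul l (ringComplex A))) := by
  have hGE := isGE_koszul l (ringComplex A) 0
  obtain ⟨b, hb, hmin⟩ := Int.exists_least_of_bdd
    (P := fun b ↦
      Nontrivial ((homologyFunctor (ModuleCat.{0} A) b).obj (koszul l (ringComplex A))))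
    ⟨0 - l.length, fun z hz ↦ by
      by_contra! hlt
      exact not_subsingleton_iff_nontrivial.2 hz
        (ModuleCat.isZero_iff_subsingleton.1 (isZero_of_isGE _ _ z hlt))⟩
    (by
      by_contra! h
      have hz : IsZero (koszul l (ringComplex A)) := (isZero_iff _).2 fun i ↦
        ModuleCat.isZero_iff_subsingleton.2 (h i)
      have h0 := HomVanishes.of_koszul_source (fun x hx ↦ smul_id_residueComplex_of_mem hl hx)
        (fun i ↦ homVanishes_of_forall (C := DerivedCategory (ModuleCat.{0} A))
          fun f ↦ hz.eq_of_src f 0) 0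
      rw [homVanishes_singleFunctor_zero] at h0
      have := (ModuleCat.homEquiv.trans
        (LinearMap.ringLmapEquivSelf A ℕ (ResidueField A)).toEquiv).subsingleton_congr.1 h0
      exact not_subsingleton (ResidueField A) this)
  refine ⟨b, (isGE_iff _ _).2 fun i hi ↦ ?_, hb⟩
  rw [ModuleCat.isZero_iff_subsingleton]
  by_contra h
  exact hi.not_ge (hmin i (not_subsingleton_iff_nontrivial.1 h))

lemma nontrivial_residueModule_hom_homology {b : ℤ} {X : DerivedCategory (ModuleCat.{0} A)}
    (hX : Module.IsFinitePowTorsion (maximalIdeal A)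
      ((homologyFunctor (ModuleCat.{0} A) b).obj X))
    (hb : Nontrivial ((homologyFunctor (ModuleCat.{0} A) b).obj X)) :
    Nontrivial (residueModule A ⟶ (homologyFunctor (ModuleCat.{0} A) b).obj X) := by
  obtain ⟨N, hN⟩ := hX.exists_pow_le
  obtain ⟨f, hf⟩ := exists_injective_residueField hN
  refine ⟨ModuleCat.ofHom f, 0, fun h ↦ one_ne_zero (α := ResidueField A) (hf ?_)⟩
  rw [map_zero]
  exact congr($(h).hom 1)

end Koszul

/-- If `t` is the depth of `A`, then a complex `N` whose highest nonzero Ext group out of the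
residue field sits in degree `s` has width `t - s`. -/
theorem exists_depth_residueComplex (A : Type) [CommRing A] [IsNoetherianRing A] [IsLocalRing A]
    [HasDerivedCategory.{w} (ModuleCat.{0} A)] :
    ∃ t : ℤ, IsLowestHomDegree (residueComplex A) (ringComplex A) t ∧
      ∀ (N : DerivedCategory (ModuleCat.{0} A)),
        ((∀ i, HomVanishes (residueComplex A) N i) → ∀ i, HomVanishes N (residueComplex A) i) ∧
        ∀ s, (∀ i, s < i → HomVanishes (residueComplex A) N i) →
          ¬ HomVanishes (residueComplex A) N s →
          IsLowestHomDegree N (residueComplex A) (t - s) := by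
  obtain ⟨S, hS⟩ := IsNoetherian.noetherian (maximalIdeal A)
  obtain ⟨l, hl⟩ : ∃ l : List A, Ideal.ofList l = maximalIdeal A :=
    ⟨S.toList, by simpa [Ideal.ofList] using hS⟩
  obtain ⟨b, hGE, hb⟩ := exists_lowest_homology_koszul_ringComplex hl
  have hLE := isLE_koszul l (ringComplex A) 0
  have htor := homology_koszul_ringComplex_isFinitePowTorsion hl
  have hk := fun x (hx : x ∈ l) ↦ smul_id_residueComplex_of_mem hl hx
  have hk' := fun x (hx : x ∈ l.reverse) ↦ hk x (List.mem_reverse.1 hx)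
  refine ⟨b + l.length, (isLowestHomDegree_of_isGE (residueModule A) (koszul l (ringComplex A)) b
    (nontrivial_residueModule_hom_homology (htor b) hb)).of_koszul_target hk rfl,
    fun N ↦ ⟨fun h ↦ ?_, fun s h hs ↦ ?_⟩⟩
  · have hz : IsZero (koszul l.reverse N) := (isZero_iff _).2 fun i ↦ by
      rw [ModuleCat.isZero_iff_subsingleton, ← homVanishes_ringComplex_iff,
        ← homVanishes_koszul_comm l _ _ rfl]
      exact homVanishes_of_homology_isFinitePowTorsion (b := b) (c := 0) htor fun _ _ ↦ h _
    exact HomVanishes.of_koszul_source hk'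
      fun i ↦ homVanishes_of_forall fun f ↦ hz.eq_of_src _ _
  · obtain ⟨c, rfl⟩ : ∃ c, s = b + l.length + c := ⟨s - (b + l.length), by lia⟩
    have hc : (koszul l.reverse N).IsLE c := (isLE_iff _ _).2 fun i hi ↦ by
      rw [ModuleCat.isZero_iff_subsingleton, ← homVanishes_ringComplex_iff,
        ← homVanishes_koszul_comm l _ _ rfl]
      exact homVanishes_of_homology_isFinitePowTorsion (b := b) (c := 0) htor
        fun _ _ ↦ h _ (by lia)
    have hne : Nontrivial ((homologyFunctor (ModuleCat.{0} A) c).obj (koszul l.reverse N)) := by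
      rw [← not_subsingleton_iff_nontrivial, ← homVanishes_ringComplex_iff,
        ← homVanishes_koszul_comm l (j := b + l.length + c - b) _ _ (by lia)]
      exact not_homVanishes_of_homology_isFinitePowTorsion (c := 0) htor hb h hs
    obtain ⟨n, hn⟩ := exists_pow_le_annihilator_homology_koszul
      (IsNoetherian.noetherian (maximalIdeal A)) (l := l.reverse)
      (by rw [← hl]; simp [Ideal.ofList]) N c
    have := nontrivial_linearMap_residueField hn
    have hlow := isLowestHomDegree_of_isLE (residueModule A) (koszul l.reverse N) c
      (ModuleCat.homEquiv.nontrivial)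
    rw [show b + l.length - (b + l.length + c) = -c by lia]
    exact hlow.of_koszul_source hk'

end DerivedCategory

open DerivedCategory Pretriangulated IsLocalRing

/-- The relation between depth, width and the highest nonvanishing Ext group out of the residue
field of a noetherian local ring. -/
theorem IsLocalRing.exists_depth_ext_residueModule (A : Type) [CommRing A] [IsNoetherianRing A]
    [IsLocalRing A] :
    ∃ t : ℕ, (∀ i < t, Subsingleton (Abelian.Ext (residueModule A) (ModuleCat.of A A) i)) ∧
      ¬ Subsingleton (Abelian.Ext (residueModule A) (ModuleCat.of A A) t) ∧
      ∀ N : ModuleCat.{0} A,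
        ((∀ i, Subsingleton (Abelian.Ext (residueModule A) N i)) →
          ∀ i, Subsingleton (Abelian.Ext N (residueModule A) i)) ∧
        ∀ s, (∀ i, s < i → Subsingleton (Abelian.Ext (residueModule A) N i)) →
          ¬ Subsingleton (Abelian.Ext (residueModule A) N s) →
          ∃ w, s + w = t ∧ (∀ i < w, Subsingleton (Abelian.Ext N (residueModule A) i)) ∧
            ¬ Subsingleton (Abelian.Ext N (residueModule A) w) := by
  let := HasDerivedCategory.standard (ModuleCat.{0} A)
  have natural {K L : ModuleCat.{0} A} {t : ℤ}
      (h : IsLowestHomDegree ((singleFunctor (ModuleCat.{0} A) 0).obj K)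
        ((singleFunctor (ModuleCat.{0} A) 0).obj L) t) :
      ∃ n : ℕ, (n : ℤ) = t ∧ (∀ i < n, Subsingleton (Abelian.Ext K L i)) ∧
        ¬ Subsingleton (Abelian.Ext K L n) := by
    obtain ⟨n, rfl⟩ : ∃ n : ℕ, t = n := ⟨t.toNat, by
      have : ¬ t < 0 := fun ht ↦ h.2 (homVanishes_singleFunctor_of_neg ht)
      lia⟩
    refine ⟨n, rfl, fun i hi ↦ ?_, ?_⟩
    · exact homVanishes_singleFunctor_natCast.1 (h.1 i (by lia))
    · exact fun hn ↦ h.2 (homVanishes_singleFunctor_natCast.2 hn)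
  obtain ⟨t, ht, H⟩ := exists_depth_residueComplex A
  obtain ⟨t, rfl, ht₁, ht₂⟩ := natural ht
  refine ⟨t, ht₁, ht₂, fun N ↦ ?_⟩
  obtain ⟨H₁, H₂⟩ := H ((singleFunctor (ModuleCat.{0} A) 0).obj N)
  refine ⟨fun h i ↦ ?_, fun s h hs ↦ ?_⟩
  · refine homVanishes_singleFunctor_natCast.1 (H₁ (fun j ↦ ?_) i)
    rcases lt_or_ge j 0 with hj | hj
    · exact homVanishes_singleFunctor_of_neg hj
    · lift j to ℕ using hj
      exact homVanishes_singleFunctor_natCast.2 (h j)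
  · obtain ⟨w, hw, hw'⟩ := natural (H₂ s (fun i hi ↦ by
      lift i to ℕ using by lia
      exact homVanishes_singleFunctor_natCast.2 (h i (by lia)))
      fun h' ↦ hs (homVanishes_singleFunctor_natCast.1 h'))
    exact ⟨w, by lia, hw'⟩

end

section EReal

variable {P : ℕ → Prop} {n : ℕ}

lemma EReal.sInf_natCast_eq (hlt : ∀ i < n, ¬ P i) (hn : P n) :
    sInf {x : EReal | ∃ i : ℕ, x = (i : EReal) ∧ P i} = n := by
  refine le_antisymm (sInf_le ⟨n, rfl, hn⟩) (le_sInf ?_)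
  rintro _ ⟨i, rfl, hi⟩
  exact EReal.natCast_le_iff.2 (not_lt.1 fun h ↦ hlt i h hi)

lemma EReal.sSup_natCast_eq (hlt : ∀ i, n < i → ¬ P i) (hn : P n) :
    sSup {x : EReal | ∃ i : ℕ, x = (i : EReal) ∧ P i} = n := by
  refine le_antisymm (sSup_le ?_) (le_sSup ⟨n, rfl, hn⟩)
  rintro _ ⟨i, rfl, hi⟩
  exact EReal.natCast_le_iff.2 (not_lt.1 fun h ↦ hlt i h hi)

end EReal

/-- For a maximal ideal `m`, if `Ext^n_R(k(m), M) = 0` for some `n ≥ dim R_m`,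
then `Ext^i_R(k(m), M) = 0` for all `i ≥ n`, and
`sup{ i : Ext^i_R(k(m), M) ≠ 0 } = depth R_m - width_{R_m} M_m`. -/
theorem ext_residueField_rigidity_at_maximal
    (R : Type) [CommRing R] [IsNoetherianRing R] (m : Ideal R) [m.IsMaximal]
    (M : Type) [AddCommGroup M] [Module R M] (n : ℕ)
    (hn : ringKrullDim (Localization.AtPrime m) ≤ (n : WithBot (WithTop ℕ)))
    (hvan : Subsingleton
      (extModule R n (ModuleCat.of R (resField R m)) (ModuleCat.of R M))) :
    (∀ i : ℕ, n ≤ i →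
      Subsingleton (extModule R i (ModuleCat.of R (resField R m)) (ModuleCat.of R M))) ∧
    extSup R (ModuleCat.of R (resField R m)) (ModuleCat.of R M)
      = edepth (Localization.AtPrime m)
          (ModuleCat.of (Localization.AtPrime m)
            (IsLocalRing.ResidueField (Localization.AtPrime m)))
          (ModuleCat.of (Localization.AtPrime m) (Localization.AtPrime m))
        - ewidth (Localization.AtPrime m)
          (ModuleCat.of (Localization.AtPrime m)
            (IsLocalRing.ResidueField (Localization.AtPrime m)))
          (ModuleCat.of (Localization.AtPrime m) (LocalizedModule m.primeCompl M)) := by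
  obtain ⟨t, ht₁, ht₂, H⟩ := IsLocalRing.exists_depth_ext_residueModule (Localization.AtPrime m)
  obtain ⟨H₁, H₂⟩ := H (ModuleCat.of _ (LocalizedModule m.primeCompl M))
  have hext (i : ℕ) := (subsingleton_extModule_iff i (ModuleCat.of R (resField R m))
    (ModuleCat.of R M)).trans (subsingleton_ext_residueField_iff m M i)
  have hvanish (i : ℕ) (hi : n ≤ i) :
      Subsingleton (extModule R i (ModuleCat.of R (resField R m)) (ModuleCat.of R M)) := by
    rw [hext] at hvan ⊢
    induction i, hi using Nat.le_induction with
    | base => exact hvan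
    | succ i hi ih =>
      exact IsLocalRing.subsingleton_ext_succ _ i (hn.trans (Nat.mono_cast (α := WithBot ℕ∞) hi)) ih
  refine ⟨hvanish, ?_⟩
  have hdepth : edepth (Localization.AtPrime m) (IsLocalRing.residueModule _)
      (ModuleCat.of _ (Localization.AtPrime m)) = t := by
    refine EReal.sInf_natCast_eq (fun i hi ↦ ?_) ?_
    · rw [not_nontrivial_iff_subsingleton, subsingleton_extModule_iff]
      exact ht₁ i hi
    · rw [← not_subsingleton_iff_nontrivial, subsingleton_extModule_iff]
      exact ht₂
  rw [hdepth]
  by_cases hall : ∀ i, Subsingleton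
      (extModule R i (ModuleCat.of R (resField R m)) (ModuleCat.of R M))
  · have hwidth : ewidth (Localization.AtPrime m) (IsLocalRing.residueModule _)
        (ModuleCat.of _ (LocalizedModule m.primeCompl M)) = ⊤ := by
      refine sInf_eq_top.2 ?_
      rintro _ ⟨i, rfl, hi⟩
      exact absurd ((subsingleton_torModule_iff _ i _).2 (H₁ (fun i ↦ (hext i).1 (hall i)) i))
        (not_subsingleton_iff_nontrivial.2 hi)
    rw [hwidth, EReal.sub_top]
    refine sSup_eq_bot.2 ?_
    rintro _ ⟨i, rfl, hi⟩
    exact absurd (hall i) (not_subsingleton_iff_nontrivial.2 hi)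
  · obtain ⟨s, hs, hmax⟩ : ∃ s, ¬ Subsingleton
        (extModule R s (ModuleCat.of R (resField R m)) (ModuleCat.of R M)) ∧
        ∀ i, s < i → Subsingleton
          (extModule R i (ModuleCat.of R (resField R m)) (ModuleCat.of R M)) := by
      classical
      obtain ⟨j, hj⟩ := not_forall.1 hall
      have hjn : j ≤ n := not_lt.1 fun h ↦ hj (hvanish j h.le)
      let P : ℕ → Prop := fun i ↦ ¬ Subsingleton
        (extModule R i (ModuleCat.of R (resField R m)) (ModuleCat.of R M))
      refine ⟨Nat.findGreatest P n, Nat.findGreatest_spec (P := P) hjn hj, fun i hi ↦ ?_⟩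
      rcases le_total n i with h | h
      · exact hvanish i h
      · exact not_not.1 (Nat.findGreatest_is_greatest hi h)
    obtain ⟨w, rfl, hw₁, hw₂⟩ := H₂ s (fun i hi ↦ (hext i).1 (hmax i hi)) fun h ↦ hs ((hext s).2 h)
    have hwidth : ewidth (Localization.AtPrime m) (IsLocalRing.residueModule _)
        (ModuleCat.of _ (LocalizedModule m.primeCompl M)) = w := by
      refine EReal.sInf_natCast_eq (fun i hi ↦ ?_) ?_
      · rw [not_nontrivial_iff_subsingleton, subsingleton_torModule_iff]
        exact hw₁ i hi
      · rw [← not_subsingleton_iff_nontrivial, subsingleton_torModule_iff]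
        exact hw₂
    have hsup : extSup R (ModuleCat.of R (resField R m)) (ModuleCat.of R M) = s :=
      EReal.sSup_natCast_eq (fun i hi ↦ not_nontrivial_iff_subsingleton.2 (hmax i hi))
        (not_subsingleton_iff_nontrivial.1 hs)
    rw [hsup, hwidth, Nat.cast_add, ← EReal.coe_natCast (n := w), EReal.add_sub_cancel_right]
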